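/- arXiv:1806.02868 — 9 statements merged into one kernel-verified Lean document; each statement's English description precedes it below -/
import Mathlib

section
/- Let Y be a semitopological semilattice satisfying the separation axiom T_{2δ} and let X ⊆ Y be a subsemilattice (a subset closed under the operation ⊓) that is complete in the subspace topology. Let x, y ∈ Y be points such that for every neighborhood O_x of x and every neighborhood O_y of y there exist points x' ∈ O_x ∩ X and y' ∈ O_y ∩ X with x' ⊓ y' = x'. Then for any (arbitrary, possibly uncountable) families 𝒰 and 𝒱 of closed neighborhoods of x and of y, respectively, there exist points x' ∈ X ∩ ⋂𝒰 and y' ∈ X ∩ ⋂𝒱 such that x' ⊓ y' = x'. -/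
/-- A topological space satisfies the separation axiom `T_{2δ}` if it is `T₁` and for every
open set `U` and every point `x ∈ U` there exists a countable family of closed neighborhoods
of `x` whose intersection is contained in `U`. -/
def IsT2Delta (X : Type*) [TopologicalSpace X] : Prop :=
  T1Space X ∧ ∀ U : Set X, IsOpen U → ∀ x ∈ U,
    ∃ 𝒰 : Set (Set X), 𝒰.Countable ∧ (∀ V ∈ 𝒰, IsClosed V ∧ V ∈ nhds x) ∧ ⋂₀ 𝒰 ⊆ U

/-- A topological space satisfies `T⃗_{2δ}` if it admits a continuous bijection onto a
`T_{2δ}`-space. -/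
def IsVecT2Delta (X : Type u) [TopologicalSpace X] : Prop :=
  ∃ (Z : Type u) (tZ : TopologicalSpace Z) (f : X → Z),
    @Continuous X Z _ tZ f ∧ Function.Bijective f ∧ @IsT2Delta Z tZ

/-- A topological space is functionally Hausdorff if distinct points are separated by a
continuous real-valued function. -/
def FunctionallyHausdorff (X : Type*) [TopologicalSpace X] : Prop :=
  ∀ x y : X, x ≠ y → ∃ f : X → ℝ, Continuous f ∧ f x ≠ f y

/-- `a` is a greatest lower bound of `C` within the subset `S`. -/
def IsGLBWithin {Y : Type*} [SemilatticeInf Y] (S C : Set Y) (a : Y) : Prop :=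
  a ∈ S ∧ (∀ c ∈ C, a ≤ c) ∧ ∀ b ∈ S, (∀ c ∈ C, b ≤ c) → b ≤ a

/-- `a` is a least upper bound of `C` within the subset `S`. -/
def IsLUBWithin {Y : Type*} [SemilatticeInf Y] (S C : Set Y) (a : Y) : Prop :=
  a ∈ S ∧ (∀ c ∈ C, c ≤ a) ∧ ∀ b ∈ S, (∀ c ∈ C, c ≤ b) → a ≤ b

/-- A topologized semilattice is complete if every nonempty chain has an infimum and a
supremum, both belonging to the closure of the chain. -/
def IsCompleteTopSemilattice (X : Type*) [SemilatticeInf X] [TopologicalSpace X] : Prop :=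
  ∀ C : Set X, C.Nonempty → IsChain (· ≤ ·) C →
    (∃ a ∈ closure C, IsGLB C a) ∧ ∃ b ∈ closure C, IsLUB C b

/-- A subsemilattice `X` of a topologized semilattice `Y` is complete (in the subspace
topology and induced order) if every nonempty chain `C ⊆ X` has a greatest lower bound and
a least upper bound within `X`, both belonging to the closure of `C`. -/
def IsCompleteSubSemilattice {Y : Type*} [SemilatticeInf Y] [TopologicalSpace Y]
    (X : Set Y) : Prop :=
  ∀ C : Set Y, C ⊆ X → C.Nonempty → IsChain (· ≤ ·) C →
    (∃ a ∈ closure C, IsGLBWithin X C a) ∧ ∃ b ∈ closure C, IsLUBWithin X C b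

section

open Set Filter Topology Cardinal

section Bounds

variable {Y : Type*} [SemilatticeInf Y]

theorem IsGLBWithin.unique {S C : Set Y} {a b : Y} (ha : IsGLBWithin S C a)
    (hb : IsGLBWithin S C b) : a = b :=
  le_antisymm (hb.2.2 a ha.1 ha.2.1) (ha.2.2 b hb.1 hb.2.1)

theorem IsLUBWithin.unique {S C : Set Y} {a b : Y} (ha : IsLUBWithin S C a)
    (hb : IsLUBWithin S C b) : a = b :=
  le_antisymm (ha.2.2 b hb.1 hb.2.1) (hb.2.2 a ha.1 ha.2.1)

theorem IsGLBWithin.of_coinitial {S C D : Set Y} {a : Y} (ha : IsGLBWithin S D a)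
    (hDC : D ⊆ C) (hcoin : ∀ c ∈ C, ∃ d ∈ D, d ≤ c) : IsGLBWithin S C a := by
  refine ⟨ha.1, fun c hc => ?_, fun b hb h => ha.2.2 b hb fun d hd => h d (hDC hd)⟩
  obtain ⟨d, hd, hdc⟩ := hcoin c hc
  exact (ha.2.1 d hd).trans hdc

theorem IsLUBWithin.of_cofinal {S C D : Set Y} {a : Y} (ha : IsLUBWithin S D a)
    (hDC : D ⊆ C) (hcof : ∀ c ∈ C, ∃ d ∈ D, c ≤ d) : IsLUBWithin S C a := by
  refine ⟨ha.1, fun c hc => ?_, fun b hb h => ha.2.2 b hb fun d hd => h d (hDC hd)⟩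
  obtain ⟨d, hd, hdc⟩ := hcof c hc
  exact hdc.trans (ha.2.1 d hd)

theorem IsGLBWithin.mono {S C D : Set Y} {a b : Y} (ha : IsGLBWithin S C a)
    (hb : IsGLBWithin S D b) (hCD : C ⊆ D) : b ≤ a :=
  ha.2.2 b hb.1 fun _ hc => hb.2.1 _ (hCD hc)

theorem IsGLBWithin.insert {S C : Set Y} {a z : Y} (hS : ∀ a ∈ S, ∀ b ∈ S, a ⊓ b ∈ S)
    (ha : IsGLBWithin S C a) (hz : z ∈ S) : IsGLBWithin S (insert z C) (a ⊓ z) := by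
  refine ⟨hS a ha.1 z hz, ?_, fun b hb h => le_inf ?_ (h z (mem_insert z C))⟩
  · rintro c (rfl | hc)
    · exact inf_le_right
    · exact inf_le_left.trans (ha.2.1 c hc)
  · exact ha.2.2 b hb fun c hc => h c (mem_insert_of_mem z hc)

theorem isGLBWithin_singleton {S : Set Y} {z : Y} (hz : z ∈ S) : IsGLBWithin S {z} z :=
  ⟨hz, fun _ hc => (mem_singleton_iff.1 hc).ge, fun _ _ h => h z rfl⟩

end Bounds

section Chains

variable {Y : Type*} [SemilatticeInf Y] [TopologicalSpace Y] {X : Set Y}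

/-- A chain in a complete subsemilattice is eventually in each neighborhood of its infimum. -/
theorem IsGLBWithin.eventually_mem (hX : IsCompleteSubSemilattice X) {C : Set Y} (hCX : C ⊆ X)
    (hne : C.Nonempty) (hC : IsChain (· ≤ ·) C) {a : Y} (ha : IsGLBWithin X C a) {O : Set Y}
    (hO : O ∈ 𝓝 a) : ∃ c₀ ∈ C, ∀ c ∈ C, c ≤ c₀ → c ∈ O := by
  by_contra! h
  let D := C \ O
  obtain ⟨c₀, hc₀⟩ := hne
  obtain ⟨d, hd, -, hdO⟩ := h c₀ hc₀
  obtain ⟨⟨a', ha', hglb⟩, -⟩ := hX D (sdiff_subset.trans hCX) ⟨d, hd, hdO⟩ (hC.mono sdiff_subset)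
  have hglb' : IsGLBWithin X C a' := hglb.of_coinitial sdiff_subset fun c hc => by
    obtain ⟨d, hd, hdc, hdO⟩ := h c hc
    exact ⟨d, ⟨hd, hdO⟩, hdc⟩
  rw [ha.unique hglb'] at hO
  obtain ⟨e, heO, -, heO'⟩ := mem_closure_iff_nhds.1 ha' O hO
  exact heO' heO

/-- A chain in a complete subsemilattice is eventually in each neighborhood of its supremum. -/
theorem IsLUBWithin.eventually_mem (hX : IsCompleteSubSemilattice X) {C : Set Y} (hCX : C ⊆ X)
    (hne : C.Nonempty) (hC : IsChain (· ≤ ·) C) {a : Y} (ha : IsLUBWithin X C a) {O : Set Y}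
    (hO : O ∈ 𝓝 a) : ∃ c₀ ∈ C, ∀ c ∈ C, c₀ ≤ c → c ∈ O := by
  by_contra! h
  let D := C \ O
  obtain ⟨c₀, hc₀⟩ := hne
  obtain ⟨d, hd, -, hdO⟩ := h c₀ hc₀
  obtain ⟨-, a', ha', hlub⟩ := hX D (sdiff_subset.trans hCX) ⟨d, hd, hdO⟩ (hC.mono sdiff_subset)
  have hlub' : IsLUBWithin X C a' := hlub.of_cofinal sdiff_subset fun c hc => by
    obtain ⟨d, hd, hdc, hdO⟩ := h c hc
    exact ⟨d, ⟨hd, hdO⟩, hdc⟩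
  rw [ha.unique hlub'] at hO
  obtain ⟨e, heO, -, heO'⟩ := mem_closure_iff_nhds.1 ha' O hO
  exact heO' heO

/-- The order relation of a complete subsemilattice is a complete subsemilattice of the square. -/
theorem IsCompleteSubSemilattice.order_relation (hX : IsCompleteSubSemilattice X) :
    IsCompleteSubSemilattice {p : Y × Y | p.1 ∈ X ∧ p.2 ∈ X ∧ p.1 ≤ p.2} := by
  intro C hCR hne hC
  have hfst : Prod.fst '' C ⊆ X := image_subset_iff.2 fun p hp => (hCR hp).1
  have hsnd : Prod.snd '' C ⊆ X := image_subset_iff.2 fun p hp => (hCR hp).2.1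
  have hC₁ : IsChain (· ≤ ·) (Prod.fst '' C) :=
    monotone_fst.isChain_image hC
  have hC₂ : IsChain (· ≤ ·) (Prod.snd '' C) :=
    monotone_snd.isChain_image hC
  obtain ⟨⟨a, -, ha⟩, a', -, ha'⟩ := hX _ hfst (hne.image _) hC₁
  obtain ⟨⟨b, -, hb⟩, b', -, hb'⟩ := hX _ hsnd (hne.image _) hC₂
  refine ⟨⟨(a, b), ?_, ⟨ha.1, hb.1, ?_⟩, ?_, ?_⟩, (a', b'), ?_, ⟨ha'.1, hb'.1, ?_⟩, ?_, ?_⟩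
  · refine mem_closure_iff_nhds.2 fun O hO => ?_
    obtain ⟨O₁, hO₁, O₂, hO₂, hsub⟩ := mem_nhds_prod_iff.1 hO
    obtain ⟨_, ⟨p, hp, rfl⟩, hpO⟩ := ha.eventually_mem hX hfst (hne.image _) hC₁ hO₁
    obtain ⟨_, ⟨q, hq, rfl⟩, hqO⟩ := hb.eventually_mem hX hsnd (hne.image _) hC₂ hO₂
    obtain ⟨r, hr, hrp, hrq⟩ : ∃ r ∈ C, r ≤ p ∧ r ≤ q := by
      rcases hC.total hp hq with h | h
      · exact ⟨p, hp, le_rfl, h⟩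
      · exact ⟨q, hq, h, le_rfl⟩
    exact ⟨r, hsub ⟨hpO _ (mem_image_of_mem _ hr) hrp.1, hqO _ (mem_image_of_mem _ hr) hrq.2⟩, hr⟩
  · refine hb.2.2 a ha.1 ?_
    rintro _ ⟨p, hp, rfl⟩
    exact (ha.2.1 _ (mem_image_of_mem _ hp)).trans (hCR hp).2.2
  · exact fun p hp => ⟨ha.2.1 _ (mem_image_of_mem _ hp), hb.2.1 _ (mem_image_of_mem _ hp)⟩
  · exact fun q hq h => ⟨ha.2.2 _ hq.1 (forall_mem_image.2 fun p hp => (h p hp).1),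
      hb.2.2 _ hq.2.1 (forall_mem_image.2 fun p hp => (h p hp).2)⟩
  · refine mem_closure_iff_nhds.2 fun O hO => ?_
    obtain ⟨O₁, hO₁, O₂, hO₂, hsub⟩ := mem_nhds_prod_iff.1 hO
    obtain ⟨_, ⟨p, hp, rfl⟩, hpO⟩ := ha'.eventually_mem hX hfst (hne.image _) hC₁ hO₁
    obtain ⟨_, ⟨q, hq, rfl⟩, hqO⟩ := hb'.eventually_mem hX hsnd (hne.image _) hC₂ hO₂
    obtain ⟨r, hr, hrp, hrq⟩ : ∃ r ∈ C, p ≤ r ∧ q ≤ r := by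
      rcases hC.total hp hq with h | h
      · exact ⟨q, hq, h, le_rfl⟩
      · exact ⟨p, hp, le_rfl, h⟩
    exact ⟨r, hsub ⟨hpO _ (mem_image_of_mem _ hr) hrp.1, hqO _ (mem_image_of_mem _ hr) hrq.2⟩, hr⟩
  · refine ha'.2.2 b' hb'.1 ?_
    rintro _ ⟨p, hp, rfl⟩
    exact (hCR hp).2.2.trans (hb'.2.1 _ (mem_image_of_mem _ hp))
  · exact fun p hp => ⟨ha'.2.1 _ (mem_image_of_mem _ hp), hb'.2.1 _ (mem_image_of_mem _ hp)⟩
  · exact fun q hq h => ⟨ha'.2.2 _ hq.1 (forall_mem_image.2 fun p hp => (h p hp).1),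
      hb'.2.2 _ hq.2.1 (forall_mem_image.2 fun p hp => (h p hp).2)⟩

/-- The infimum of the values of `f` on `I`, as the limit of the infima over the segments
`Icc β α`, `α ∈ I`. -/
theorem IsCompleteSubSemilattice.exists_glb_image (hX : IsCompleteSubSemilattice X) {ι : Type*}
    [LinearOrder ι] {f : ι → Y} {I : Set ι} {β : ι} (hβ : β ∈ I) (hI : I ⊆ Ici β)
    (hord : ∀ α ∈ I, Icc β α ⊆ I) (hex : ∀ α ∈ I, ∃ w, IsGLBWithin X (f '' Icc β α) w) :
    ∃ m ∈ closure {w | ∃ α ∈ I, IsGLBWithin X (f '' Icc β α) w}, IsGLBWithin X (f '' I) m := by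
  let C := {w | ∃ α ∈ I, IsGLBWithin X (f '' Icc β α) w}
  have hCX : C ⊆ X := fun w ⟨α, _, hw⟩ => hw.1
  have hne : C.Nonempty := by
    obtain ⟨w, hw⟩ := hex β hβ
    exact ⟨w, β, hβ, hw⟩
  have hC : IsChain (· ≤ ·) C := by
    rintro w ⟨α, -, hw⟩ w' ⟨α', -, hw'⟩ -
    rcases le_total α α' with h | h
    · exact Or.inr (hw.mono hw' (image_mono (Icc_subset_Icc_right h)))
    · exact Or.inl (hw'.mono hw (image_mono (Icc_subset_Icc_right h)))
  obtain ⟨⟨m, hmC, hm⟩, -⟩ := hX C hCX hne hC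
  refine ⟨m, hmC, hm.1, ?_, fun b hb h => hm.2.2 b hb ?_⟩
  · rintro _ ⟨α, hα, rfl⟩
    obtain ⟨w, hw⟩ := hex α hα
    exact (hm.2.1 w ⟨α, hα, hw⟩).trans (hw.2.1 _ (mem_image_of_mem _ (right_mem_Icc.2 (hI hα))))
  · rintro w ⟨α, hα, hw⟩
    exact hw.2.2 b hb fun c hc => h c (image_mono (hord α hα) hc)

end Chains

/-- Transfinite construction of a function all of whose initial parts satisfy a property. -/
theorem exists_forall_of_forall_update {ι Y : Type*} [LinearOrder ι] [WellFoundedLT ι] [Nonempty Y]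
    (P : (ι → Y) → ι → Prop)
    (hcongr : ∀ f g α, (∀ β ≤ α, f β = g β) → P f α → P g α)
    (hstep : ∀ f α, (∀ β < α, P f β) → ∃ z, P (Function.update f α z) α) :
    ∃ f, ∀ α, P f α := by
  classical
  obtain ⟨y₀⟩ := ‹Nonempty Y›
  have hstep' : ∀ f α, ∃ z, (∀ β < α, P f β) → P (Function.update f α z) α := fun f α => by
    by_cases h : ∀ β < α, P f β
    · obtain ⟨z, hz⟩ := hstep f α h
      exact ⟨z, fun _ => hz⟩
    · exact ⟨y₀, fun h' => (h h').elim⟩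
  choose s hs using hstep'
  let G : ∀ α : ι, (∀ β, β < α → Y) → Y := fun α g => s (fun β => if h : β < α then g β h else y₀) α
  let f : ι → Y := (wellFounded_lt (α := ι)).fix G
  have hf : ∀ α, f α = s (fun β => if β < α then f β else y₀) α := fun α => by
    have := (wellFounded_lt (α := ι)).fix_eq G α
    simpa [G, f] using this
  refine ⟨f, fun α => ?_⟩
  induction α using WellFoundedLT.induction with
  | ind α ih =>
    refine hcongr _ _ α ?_ (hs (fun β => if β < α then f β else y₀) α fun β hβ => ?_)
    · intro β hβ
      rcases hβ.lt_or_eq with h | rfl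
      · simp [Function.update_of_ne h.ne, h]
      · simp [← hf]
    · refine hcongr f _ β (fun γ hγ => ?_) (ih β hβ)
      simp [hγ.trans_lt hβ]

section Construction

variable {Y : Type*} [SemilatticeInf Y] [TopologicalSpace Y]

theorem IsCompleteSubSemilattice.exists_mem_closure_of_wellOrder
    (hsemi : ∀ a : Y, Continuous fun y => a ⊓ y) {X : Set Y}
    (hsub : ∀ a ∈ X, ∀ b ∈ X, a ⊓ b ∈ X) (hX : IsCompleteSubSemilattice X)
    {ι : Type*} [LinearOrder ι] [WellFoundedLT ι] [Nonempty ι] {x : Y} (l : Filter Y)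
    (F : ι → Set Y)
    (hclosed : (∀ γ, IsClosed (F γ)) ∨ (T1Space Y ∧ ∀ α : ι, (Iio α).Finite))
    (hxF : ∀ γ, x ∈ F γ) (hFl : ∀ γ, F γ ∈ l)
    (hF : ∀ γ w, w ⊓ x ∈ F γ → {z | w ⊓ z ∈ F γ} ∈ l)
    (hl : ∀ (α : ι) (s : ι → ι → Set Y), (∀ β γ, s β γ ∈ l) →
      ∃ z ∈ X, ∀ β ≤ α, ∀ γ ≤ α, z ∈ s β γ) :
    ∃ z ∈ X, ∀ γ, z ∈ closure (F γ) := by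
  classical
  let P : (ι → Y) → ι → Prop := fun f α => f α ∈ X ∧ ∀ β ≤ α, ∃ w,
    IsGLBWithin X (f '' Icc β α) w ∧ ∀ γ ≤ β, w ∈ F γ ∧ w ⊓ x ∈ F γ
  have : Nonempty Y := ⟨x⟩
  obtain ⟨f, hf⟩ : ∃ f, ∀ α, P f α := by
    refine exists_forall_of_forall_update P ?_ ?_
    · rintro f g α hfg ⟨hfX, h⟩
      refine ⟨hfg α le_rfl ▸ hfX, fun β hβ => ?_⟩
      have : g '' Icc β α = f '' Icc β α := image_congr fun γ hγ => (hfg γ hγ.2).symm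
      rw [this]
      exact h β hβ
    · intro f α hα
      have hglb : ∀ β < α, ∃ m, IsGLBWithin X (f '' Ico β α) m ∧
          ∀ γ ≤ β, m ∈ F γ ∧ m ⊓ x ∈ F γ := by
        intro β hβ
        have hex : ∀ δ ∈ Ico β α, ∃ w, IsGLBWithin X (f '' Icc β δ) w := fun δ hδ =>
          ((hα δ hδ.2).2 β hδ.1).imp fun w hw => hw.1
        obtain ⟨m, hmC, hm⟩ := hX.exists_glb_image (left_mem_Ico.2 hβ) (fun δ hδ => hδ.1)
          (fun δ hδ => Icc_subset_Ico_right hδ.2) hex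
        have hCF : ∀ w ∈ {w | ∃ δ ∈ Ico β α, IsGLBWithin X (f '' Icc β δ) w}, ∀ γ ≤ β,
            w ∈ F γ ∧ w ⊓ x ∈ F γ := by
          rintro w ⟨δ, hδ, hw⟩
          obtain ⟨w', hw', hwF⟩ := (hα δ hδ.2).2 β hδ.1
          rwa [hw.unique hw']
        refine ⟨m, hm, ?_⟩
        rcases hclosed with hcl | ⟨hT1, hfin⟩
        · intro γ hγ
          refine ⟨closure_minimal (fun w hw => (hCF w hw γ hγ).1) (hcl γ) hmC, ?_⟩
          have hcl' : IsClosed {w | w ⊓ x ∈ F γ} := by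
            simp_rw [inf_comm _ x]
            exact (hcl γ).preimage (hsemi x)
          exact closure_minimal (fun w hw => (hCF w hw γ hγ).2) hcl' hmC
        · have hCfin : {w | ∃ δ ∈ Ico β α, IsGLBWithin X (f '' Icc β δ) w}.Finite := by
            have : {w | ∃ δ ∈ Ico β α, IsGLBWithin X (f '' Icc β δ) w} =
                ⋃ δ ∈ Ico β α, {w | IsGLBWithin X (f '' Icc β δ) w} := by
              ext w
              simp
            rw [this]
            refine ((hfin α).subset fun δ hδ => hδ.2).biUnion fun δ _ => ?_
            exact Set.Subsingleton.finite fun a ha b hb => IsGLBWithin.unique ha hb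
          rw [hCfin.isClosed.closure_eq] at hmC
          exact hCF m hmC
      choose! m hm hmF using hglb
      obtain ⟨z, hzX, hz⟩ := hl α (fun β γ => {z | z ∈ F γ ∧ x ⊓ z ∈ F γ ∧
          (β < α → γ ≤ β → m β ⊓ z ∈ F γ ∧ m β ⊓ x ⊓ z ∈ F γ)}) fun β γ => by
        refine inter_mem (hFl γ) (inter_mem (hF γ x (by simpa using hxF γ)) ?_)
        by_cases h : β < α ∧ γ ≤ β
        · have h₁ := hF γ (m β) (hmF β h.1 γ h.2).2
          have h₂ := hF γ (m β ⊓ x) (by simpa [inf_assoc] using (hmF β h.1 γ h.2).2)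
          filter_upwards [h₁, h₂] with z hz₁ hz₂ using fun _ _ => ⟨hz₁, hz₂⟩
        · exact univ_mem' fun z h₁ h₂ => (h ⟨h₁, h₂⟩).elim
      refine ⟨z, by simpa using hzX, fun β hβ => ?_⟩
      have himage : Function.update f α z '' Icc β α = insert z (f '' Ico β α) := by
        rw [← Ico_insert_right hβ, image_insert_eq, Function.update_self]
        congr 1
        exact image_congr fun γ hγ => Function.update_of_ne hγ.2.ne _ _
      rw [himage]
      rcases hβ.lt_or_eq with h | rfl
      · refine ⟨m β ⊓ z, (hm β h).insert hsub hzX, fun γ hγ => ?_⟩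
        obtain ⟨-, -, hz'⟩ := hz β hβ γ (hγ.trans hβ)
        refine ⟨(hz' h hγ).1, ?_⟩
        rw [inf_right_comm]
        exact (hz' h hγ).2
      · refine ⟨z, by simpa using isGLBWithin_singleton hzX, fun γ hγ => ?_⟩
        obtain ⟨hz₁, hz₂, -⟩ := hz β le_rfl γ hγ
        exact ⟨hz₁, by rwa [inf_comm]⟩
  have hglb : ∀ β, ∃ m, IsGLBWithin X (f '' Ici β) m ∧ ∀ γ ≤ β, m ∈ closure (F γ) := by
    intro β
    obtain ⟨m, hmC, hm⟩ := hX.exists_glb_image (f := f) (self_mem_Ici (a := β)) subset_rfl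
      (fun δ _ => Icc_subset_Ici_self) fun δ hδ => ((hf δ).2 β hδ).imp fun w hw => hw.1
    refine ⟨m, hm, fun γ hγ => closure_mono ?_ hmC⟩
    rintro w ⟨δ, hδ, hw⟩
    obtain ⟨w', hw', hwF⟩ := (hf δ).2 β hδ
    rw [hw.unique hw']
    exact (hwF γ hγ).1
  choose m hm hmF using hglb
  have hmono : Monotone m := fun β β' h => (hm β').mono (hm β) (image_mono (Ici_subset_Ici.2 h))
  have hchain : IsChain (· ≤ ·) (range m) := hmono.isChain_range
  have hmX : range m ⊆ X := range_subset_iff.2 fun β => (hm β).1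
  obtain ⟨-, d, -, hd⟩ := hX _ hmX (range_nonempty m) hchain
  refine ⟨d, hd.1, fun γ => ?_⟩
  have hsubset : m '' Ici γ ⊆ range m := image_subset_range m _
  obtain ⟨-, d', hd'C, hd'⟩ := hX (m '' Ici γ) (hsubset.trans hmX) ⟨m γ, γ, self_mem_Ici, rfl⟩
    (hchain.mono hsubset)
  have hdd' : d' = d := by
    refine IsLUBWithin.unique (hd'.of_cofinal hsubset ?_) hd
    rintro _ ⟨β, rfl⟩
    exact ⟨m (max β γ), ⟨_, le_max_right β γ, rfl⟩, hmono (le_max_left β γ)⟩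
  rw [← hdd']
  refine closure_minimal ?_ isClosed_closure hd'C
  rintro _ ⟨β, hβ, rfl⟩
  exact hmF β γ hβ

end Construction

section Separation

variable {Y : Type*} [TopologicalSpace Y]

theorem IsT2Delta.exists_countable (hY : IsT2Delta Y) {x : Y} {N : Set Y} (hN : N ∈ 𝓝 x) :
    ∃ 𝒲 : Set (Set Y), 𝒲.Countable ∧ (∀ V ∈ 𝒲, IsClosed V ∧ V ∈ 𝓝 x) ∧ ⋂₀ 𝒲 ⊆ interior N :=
  hY.2 _ isOpen_interior x (mem_interior_iff_mem_nhds.2 hN)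

/-- In a `T_{2δ}`-space every neighborhood of `x` contains the intersection `F` of a countable
family of closed neighborhoods of `x`, each of them a neighborhood of the whole set `F`. -/
theorem IsT2Delta.exists_countable_nhds (hY : IsT2Delta Y) {x : Y} {N : Set Y} (hN : N ∈ 𝓝 x) :
    ∃ 𝒲 : Set (Set Y), 𝒲.Countable ∧ (∀ V ∈ 𝒲, IsClosed V ∧ V ∈ 𝓝 x) ∧ ⋂₀ 𝒲 ⊆ N ∧
      ∀ V ∈ 𝒲, ⋂₀ 𝒲 ⊆ interior V := by
  have hex : ∀ N : Set Y, ∃ 𝒲 : Set (Set Y), N ∈ 𝓝 x →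
      𝒲.Countable ∧ (∀ V ∈ 𝒲, IsClosed V ∧ V ∈ 𝓝 x) ∧ ⋂₀ 𝒲 ⊆ interior N := fun N => by
    by_cases h : N ∈ 𝓝 x
    · exact (hY.exists_countable h).imp fun _ h' _ => h'
    · exact ⟨∅, fun h' => (h h').elim⟩
  choose c hc using hex
  let A : ℕ → Set (Set Y) := fun n => n.rec (c N) fun _ B => ⋃ V ∈ B, c V
  have hA : ∀ n, (A n).Countable ∧ ∀ V ∈ A n, IsClosed V ∧ V ∈ 𝓝 x := by
    intro n
    induction n with
    | zero => exact ⟨(hc N hN).1, (hc N hN).2.1⟩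
    | succ n ih =>
      refine ⟨ih.1.biUnion fun V hV => (hc V (ih.2 V hV).2).1, fun V hV => ?_⟩
      obtain ⟨W, hW, hVW⟩ := mem_iUnion₂.1 hV
      exact (hc W (ih.2 W hW).2).2.1 V hVW
  refine ⟨⋃ n, A n, countable_iUnion fun n => (hA n).1, fun V hV => ?_, ?_, fun V hV => ?_⟩
  · obtain ⟨n, hn⟩ := mem_iUnion.1 hV
    exact (hA n).2 V hn
  · exact (sInter_subset_sInter (subset_iUnion A 0)).trans ((hc N hN).2.2.trans interior_subset)
  · obtain ⟨n, hn⟩ := mem_iUnion.1 hV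
    refine (sInter_subset_sInter ?_).trans (hc V ((hA n).2 V hn).2).2.2
    exact (subset_biUnion_of_mem (u := c) hn).trans (subset_iUnion A (n + 1))

theorem IsT2Delta.prod {Z : Type*} [TopologicalSpace Z] (hY : IsT2Delta Y) (hZ : IsT2Delta Z) :
    IsT2Delta (Y × Z) := by
  have := hY.1
  have := hZ.1
  refine ⟨inferInstance, fun U hU p hp => ?_⟩
  obtain ⟨N₁, hN₁, N₂, hN₂, hN⟩ := mem_nhds_prod_iff.1 (hU.mem_nhds hp)
  obtain ⟨𝒲₁, hcount₁, hW₁, hsub₁⟩ := hY.exists_countable hN₁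
  obtain ⟨𝒲₂, hcount₂, hW₂, hsub₂⟩ := hZ.exists_countable hN₂
  refine ⟨preimage Prod.fst '' 𝒲₁ ∪ preimage Prod.snd '' 𝒲₂,
    (hcount₁.image _).union (hcount₂.image _), ?_, fun q hq => hN ⟨?_, ?_⟩⟩
  · rintro _ (⟨V, hV, rfl⟩ | ⟨V, hV, rfl⟩)
    · exact ⟨(hW₁ V hV).1.preimage continuous_fst, continuous_fst.continuousAt (hW₁ V hV).2⟩
    · exact ⟨(hW₂ V hV).1.preimage continuous_snd, continuous_snd.continuousAt (hW₂ V hV).2⟩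
  · exact interior_subset (hsub₁ fun V hV => hq _ (Or.inl (mem_image_of_mem _ hV)))
  · exact interior_subset (hsub₂ fun V hV => hq _ (Or.inr (mem_image_of_mem _ hV)))

end Separation

/-- A complete subsemilattice meets every intersection of neighborhoods of a point of its
closure. -/
theorem IsCompleteSubSemilattice.inter_iInter_nhds_nonempty
    {Y : Type*} [SemilatticeInf Y] [TopologicalSpace Y]
    (hsemi : ∀ a : Y, Continuous fun y => a ⊓ y) (hY : IsT2Delta Y) {X : Set Y}
    (hsub : ∀ a ∈ X, ∀ b ∈ X, a ⊓ b ∈ X) (hX : IsCompleteSubSemilattice X) {x : Y}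
    (hx : x ∈ closure X) {ι : Type*} (N : ι → Set Y) (hN : ∀ i, N i ∈ 𝓝 x) :
    ∃ z ∈ X, ∀ i, z ∈ N i := by
  induction hκ : #ι using WellFoundedLT.induction generalizing ι with
  | ind κ ih =>
  subst hκ
  have hmeet : ∀ O ∈ 𝓝 x, ∃ z ∈ X, z ∈ O := fun O hO => by
    obtain ⟨z, hzO, hzX⟩ := mem_closure_iff_nhds.1 hx O hO
    exact ⟨z, hzX, hzO⟩
  rcases finite_or_infinite ι with h | hinf
  · exact (hmeet _ (iInter_mem.2 hN)).imp fun z hz => ⟨hz.1, mem_iInter.1 hz.2⟩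
  choose 𝒲 hcount hW hsubN hint using fun i => hY.exists_countable_nhds (hN i)
  rcases le_or_gt #ι ℵ₀ with hle | hgt
  · have : Countable ι := mk_le_aleph0_iff.1 hle
    have hcl : ∀ V ∈ insert Set.univ (⋃ i, 𝒲 i), IsClosed V ∧ V ∈ 𝓝 x := by
      rintro V (rfl | hV)
      · exact ⟨isClosed_univ, univ_mem⟩
      · obtain ⟨i, hi⟩ := mem_iUnion.1 hV
        exact hW i V hi
    obtain ⟨u, hu⟩ := ((countable_iUnion hcount).insert Set.univ).exists_eq_range
      (insert_nonempty _ _)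
    rw [hu, forall_mem_range] at hcl
    have hxu (n : ℕ) : x ∈ interior (u n) := mem_interior_iff_mem_nhds.2 (hcl n).2
    obtain ⟨z, hzX, hz⟩ := hX.exists_mem_closure_of_wellOrder hsemi hsub (x := x) (𝓝 x)
      (fun n : ℕ => interior (u n)) (Or.inr ⟨hY.1, finite_Iio⟩) hxu
      (fun n => isOpen_interior.mem_nhds (hxu n))
      (fun n w hw => (hsemi w).continuousAt (isOpen_interior.mem_nhds hw))
      (fun n s hs => by
        obtain ⟨z, hzX, hz⟩ := hmeet (⋂ p : Iic n × Iic n, s p.1 p.2)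
          (iInter_mem.2 fun p => hs p.1 p.2)
        exact ⟨z, hzX, fun β hβ γ hγ => mem_iInter.1 hz (⟨β, hβ⟩, ⟨γ, hγ⟩)⟩)
    refine ⟨z, hzX, fun i => hsubN i fun V hV => ?_⟩
    obtain ⟨n, rfl⟩ := hu ▸ mem_insert_of_mem Set.univ (mem_iUnion.2 ⟨i, hV⟩)
    exact closure_minimal interior_subset (hcl n).1 (hz n)
  · obtain ⟨_, _, hord⟩ := exists_ord_eq_type_lt ι
    have hIio (α : ι) : #(Iio α) < #ι := mk_Iio_lt α hord
    have hclosed (i : ι) : IsClosed (⋂₀ 𝒲 i) := isClosed_sInter fun V hV => (hW i V hV).1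
    obtain ⟨z, hzX, hz⟩ := hX.exists_mem_closure_of_wellOrder hsemi hsub (x := x)
      (countableGenerate (𝓝 x).sets) (fun i => ⋂₀ 𝒲 i) (Or.inl hclosed)
      (fun i V hV => mem_of_mem_nhds (hW i V hV).2)
      (fun i => mem_countableGenerate_iff.2
        ⟨𝒲 i, fun V hV => (hW i V hV).2, hcount i, subset_rfl⟩)
      (fun i w hw => by
        refine mem_countableGenerate_iff.2 ⟨(fun V => {z | w ⊓ z ∈ V}) '' 𝒲 i, ?_,
          (hcount i).image _, fun z hz V hV => hz _ (mem_image_of_mem _ hV)⟩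
        rintro _ ⟨V, hV, rfl⟩
        exact (hsemi w).continuousAt (mem_interior_iff_mem_nhds.1 (hint i V hV hw)))
      (fun α s hs => by
        have hseq (β γ : ι) : ∃ u : ℕ → Set Y, (∀ n, u n ∈ 𝓝 x) ∧ ⋂ n, u n ⊆ s β γ := by
          obtain ⟨S, hS, hScount, hSs⟩ := mem_countableGenerate_iff.1 (hs β γ)
          obtain ⟨u, hu⟩ := (hScount.insert Set.univ).exists_eq_range (insert_nonempty _ _)
          refine ⟨u, fun n => ?_, fun z hz => hSs fun V hV => ?_⟩
          · rcases hu ▸ mem_range_self n with h | h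
            · exact h ▸ univ_mem
            · exact hS h
          · obtain ⟨n, rfl⟩ := hu ▸ mem_insert_of_mem Set.univ hV
            exact mem_iInter.1 hz n
        choose u hu hus using hseq
        have hIic : #(Iic α) < #ι := by
          rw [← Iio_insert]
          exact (mk_insert_le).trans_lt (add_lt_of_lt hgt.le (hIio α) (one_lt_aleph0.trans hgt))
        obtain ⟨z, hzX, hz⟩ := ih #(Iic α × Iic α × ℕ) (by
          simpa using mul_lt_of_lt hgt.le hIic (mul_lt_of_lt hgt.le hIic hgt))
          (fun p : Iic α × Iic α × ℕ => u p.1 p.2.1 p.2.2) (fun p => hu _ _ _) rfl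
        exact ⟨z, hzX, fun β hβ γ hγ => hus β γ
          (mem_iInter.2 fun n => hz (⟨β, hβ⟩, ⟨γ, hγ⟩, n))⟩)
    exact ⟨z, hzX, fun i => hsubN i ((hclosed i).closure_eq ▸ hz i)⟩

end

/-- arbitrary families of closed neighborhoods version, under `T_{2δ}`. -/
theorem stmt8 {Y : Type*} [SemilatticeInf Y] [TopologicalSpace Y]
    (hsemi : ∀ a : Y, Continuous fun y => a ⊓ y)
    (hY : IsT2Delta Y)
    (X : Set Y) (hsub : ∀ a ∈ X, ∀ b ∈ X, a ⊓ b ∈ X)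
    (hX : IsCompleteSubSemilattice X)
    (x y : Y)
    (hxy : ∀ Ox ∈ nhds x, ∀ Oy ∈ nhds y, ∃ x' ∈ Ox ∩ X, ∃ y' ∈ Oy ∩ X, x' ⊓ y' = x')
    (𝒰 𝒱 : Set (Set Y))
    (h𝒰 : ∀ U ∈ 𝒰, IsClosed U ∧ U ∈ nhds x)
    (h𝒱 : ∀ V ∈ 𝒱, IsClosed V ∧ V ∈ nhds y) :
    ∃ x' ∈ X ∩ ⋂₀ 𝒰, ∃ y' ∈ X ∩ ⋂₀ 𝒱, x' ⊓ y' = x' := by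
  let R : Set (Y × Y) := {p | p.1 ∈ X ∧ p.2 ∈ X ∧ p.1 ≤ p.2}
  have hR : ∀ p ∈ R, ∀ q ∈ R, p ⊓ q ∈ R := fun p hp q hq =>
    ⟨hsub _ hp.1 _ hq.1, hsub _ hp.2.1 _ hq.2.1, inf_le_inf hp.2.2 hq.2.2⟩
  have hsemi' : ∀ a : Y × Y, Continuous fun p => a ⊓ p := fun a =>
    ((hsemi a.1).comp continuous_fst).prodMk ((hsemi a.2).comp continuous_snd)
  have hmem : (x, y) ∈ closure R := by
    refine mem_closure_iff_nhds.2 fun O hO => ?_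
    obtain ⟨O₁, hO₁, O₂, hO₂, hO'⟩ := mem_nhds_prod_iff.1 hO
    obtain ⟨x', hx', y', hy', h⟩ := hxy O₁ hO₁ O₂ hO₂
    exact ⟨(x', y'), hO' ⟨hx'.1, hy'.1⟩, hx'.2, hy'.2, inf_eq_left.1 h⟩
  obtain ⟨p, hp, hpN⟩ := hX.order_relation.inter_iInter_nhds_nonempty hsemi' (hY.prod hY) hR hmem
    (Sum.elim (fun U : 𝒰 => Prod.fst ⁻¹' U.1) fun V : 𝒱 => Prod.snd ⁻¹' V.1) (by
      rintro (U | V)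
      · exact continuous_fst.continuousAt (h𝒰 U.1 U.2).2
      · exact continuous_snd.continuousAt (h𝒱 V.1 V.2).2)
  exact ⟨p.1, ⟨hp.1, fun U hU => hpN (Sum.inl ⟨U, hU⟩)⟩, p.2,
    ⟨hp.2.1, fun V hV => hpN (Sum.inr ⟨V, hV⟩)⟩, inf_eq_left.2 hp.2.2⟩
end

section
/- Every subspace of a topological space satisfying the separation axiom T_{2δ} satisfies T_{2δ}. -/
/-- subspaces of `T_{2δ}`-spaces are `T_{2δ}`. -/
theorem stmt10 {X : Type*} [TopologicalSpace X] (hX : IsT2Delta X) (S : Set X) :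
    IsT2Delta S := by
  obtain ⟨hT1, h⟩ := hX
  refine ⟨inferInstance, ?_⟩
  rintro _ ⟨U, hU, rfl⟩ x hx
  obtain ⟨𝒰, hc, hn, hs⟩ := h U hU x hx
  refine ⟨(fun V : Set X => ((↑) : S → X) ⁻¹' V) '' 𝒰, hc.image _, ?_, ?_⟩
  · rintro _ ⟨V, hV, rfl⟩
    exact ⟨(hn V hV).1.preimage continuous_subtype_val,
      continuous_subtype_val.continuousAt (hn V hV).2⟩
  · intro y hy
    exact hs fun V hV => hy _ ⟨V, hV, rfl⟩
end

section
/- An arbitrary Tychonoff product of topological spaces each satisfying the separation axiom T_{2δ} satisfies T_{2δ}. -/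
/-- products of `T_{2δ}`-spaces are `T_{2δ}`. -/
theorem stmt11 {ι : Type*} (X : ι → Type*) [∀ i, TopologicalSpace (X i)]
    (hX : ∀ i, IsT2Delta (X i)) : IsT2Delta (∀ i, X i) := by
  have := fun i => (hX i).1
  refine ⟨inferInstance, fun U hU x hx => ?_⟩
  obtain ⟨I, u, hu, hIU⟩ := isOpen_pi_iff.1 hU x hx
  choose! 𝒱 h𝒱c h𝒱n h𝒱u using fun i (hi : i ∈ I) => (hX i).2 (u i) (hu i hi).1 (x i) (hu i hi).2
  refine ⟨⋃ i ∈ I, (fun V => Function.eval i ⁻¹' V) '' 𝒱 i,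
    I.countable_toSet.biUnion fun i hi => (h𝒱c i hi).image _, ?_, fun y hy => hIU fun i hi => ?_⟩
  · intro V hV
    simp only [Set.mem_iUnion] at hV
    obtain ⟨i, hi, W, hW, rfl⟩ := hV
    exact ⟨(h𝒱n i hi W hW).1.preimage (continuous_apply i),
      (continuous_apply i).continuousAt.preimage_mem_nhds (h𝒱n i hi W hW).2⟩
  · exact h𝒱u i hi fun W hW => hy _ (Set.mem_biUnion hi ⟨W, hW, rfl⟩)
end

section
/- Every functionally Hausdorff topological space X satisfies the separation axiom T⃗_{2δ}: there exists a topological space Z satisfying T_{2δ} and a continuous bijection from X onto Z. -/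
/-- Every `T₃`-space is a `T_{2δ}`-space. -/
theorem isT2Delta_of_t3Space (Z : Type*) [TopologicalSpace Z] [T3Space Z] : IsT2Delta Z := by
  refine ⟨inferInstance, fun U hU x hx => ?_⟩
  obtain ⟨V, hV, hVc, hVU⟩ := exists_mem_nhds_isClosed_subset (hU.mem_nhds hx)
  refine ⟨{V}, Set.countable_singleton V, ?_, ?_⟩
  · rintro W rfl
    exact ⟨hVc, hV⟩
  · rwa [Set.sInter_singleton]

/-- every functionally Hausdorff space satisfies `T⃗_{2δ}`. -/
theorem stmt14 {X : Type u} [TopologicalSpace X] (hX : FunctionallyHausdorff X) :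
    IsVecT2Delta X := by
  let φ : X → C(X, ℝ) → ℝ := fun x f => f x
  have hφ : Continuous φ := continuous_pi fun f => f.continuous
  have hinj : Function.Injective φ := by
    intro x y hxy
    by_contra hne
    obtain ⟨f, hf, hfxy⟩ := hX x y hne
    exact hfxy (congrFun hxy ⟨f, hf⟩)
  let tZ : TopologicalSpace X := TopologicalSpace.induced φ inferInstance
  refine ⟨X, tZ, id, continuous_induced_rng.2 hφ, Function.bijective_id, ?_⟩
  have hemb : @Topology.IsEmbedding X _ tZ _ φ := @Topology.IsEmbedding.mk _ _ tZ _ _ ⟨rfl⟩ hinj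
  have : @T3Space X tZ := @Topology.IsEmbedding.t3Space _ _ tZ _ _ _ hemb
  exact @isT2Delta_of_t3Space X tZ this
end

section
/- Let Y be a semitopological semilattice satisfying the separation axiom T⃗_{2δ}. Then there exists a topology τ on Y, coarser than the given topology, such that (Y, τ) satisfies the separation axiom T_{2δ} and (Y, τ) is a semitopological semilattice, i.e., for every a ∈ Y the shift y ↦ a ⊓ y is τ-continuous. -/
/-- The topology generated by a family of maps into a `T_{2δ}`-space, one of which is
injective, satisfies `T_{2δ}`. -/
theorem IsT2Delta.generateFrom_preimage {ι X Z : Type*} [TopologicalSpace Z] (hZ : IsT2Delta Z)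
    (g : ι → X → Z) (i₀ : ι) (hi₀ : Function.Injective (g i₀)) :
    @IsT2Delta X (TopologicalSpace.generateFrom
      {S | ∃ i, ∃ V : Set Z, IsOpen V ∧ g i ⁻¹' V = S}) := by
  let τ : TopologicalSpace X :=
    TopologicalSpace.generateFrom {S | ∃ i, ∃ V : Set Z, IsOpen V ∧ g i ⁻¹' V = S}
  have hg (i : ι) : Continuous (g i) :=
    ⟨fun V hV => TopologicalSpace.isOpen_generateFrom_of_mem ⟨i, V, hV, rfl⟩⟩
  obtain ⟨hT1, hδ⟩ := hZ
  refine ⟨t1Space_of_injective_of_continuous hi₀ (hg i₀), fun U hU => ?_⟩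
  induction hU with
  | basic S hS =>
    obtain ⟨i, V, hV, rfl⟩ := hS
    intro x hx
    obtain ⟨𝒰, hc, hn, hsub⟩ := hδ V hV (g i x) hx
    refine ⟨(g i ⁻¹' ·) '' 𝒰, hc.image _, ?_, fun y hy => hsub fun W hW => ?_⟩
    · rintro _ ⟨W, hW, rfl⟩
      exact ⟨(hn W hW).1.preimage (hg i), (hg i).continuousAt.preimage_mem_nhds (hn W hW).2⟩
    · exact hy _ ⟨W, hW, rfl⟩
  | univ => exact fun x _ => ⟨∅, Set.countable_empty, by simp, Set.subset_univ _⟩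
  | inter S T _ _ ihS ihT =>
    intro x hx
    obtain ⟨𝒰, hc, hn, hsub⟩ := ihS x hx.1
    obtain ⟨𝒱, hc', hn', hsub'⟩ := ihT x hx.2
    refine ⟨𝒰 ∪ 𝒱, hc.union hc', fun V hV => hV.elim (hn V) (hn' V), ?_⟩
    rw [Set.sInter_union]
    exact Set.inter_subset_inter hsub hsub'
  | sUnion 𝒮 _ ih =>
    rintro x ⟨S, hS, hx⟩
    obtain ⟨𝒰, hc, hn, hsub⟩ := ih S hS x hx
    exact ⟨𝒰, hc, hn, hsub.trans (Set.subset_sUnion_of_mem hS)⟩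

/-- a semitopological semilattice satisfying `T⃗_{2δ}` admits a coarser
`T_{2δ}` topology in which it is still a semitopological semilattice. -/
theorem stmt15 {Y : Type u} [SemilatticeInf Y] [t : TopologicalSpace Y]
    (hsemi : ∀ a : Y, Continuous fun y => a ⊓ y)
    (hY : IsVecT2Delta Y) :
    ∃ τ : TopologicalSpace Y, (∀ U : Set Y, τ.IsOpen U → t.IsOpen U) ∧
      @IsT2Delta Y τ ∧ ∀ a : Y, @Continuous Y Y τ τ (fun y => a ⊓ y) := by
  obtain ⟨Z, tZ, f, hf, hbij, hZ⟩ := hY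
  let g : Option Y → Y → Z := fun o y => o.elim (f y) fun a => f (a ⊓ y)
  refine ⟨TopologicalSpace.generateFrom {S | ∃ i, ∃ V : Set Z, IsOpen V ∧ g i ⁻¹' V = S},
    ?_, hZ.generateFrom_preimage g none hbij.injective, fun a => ?_⟩
  · have hle : t ≤ TopologicalSpace.generateFrom
        {S | ∃ i, ∃ V : Set Z, IsOpen V ∧ g i ⁻¹' V = S} := by
      refine le_generateFrom ?_
      rintro _ ⟨_ | a, V, hV, rfl⟩
      · exact hV.preimage hf
      · exact hV.preimage (hf.comp (hsemi a))
    exact hle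
  · refine continuous_generateFrom_iff.2 ?_
    rintro _ ⟨_ | b, V, hV, rfl⟩
    · exact TopologicalSpace.isOpen_generateFrom_of_mem ⟨some a, V, hV, rfl⟩
    · refine TopologicalSpace.isOpen_generateFrom_of_mem ⟨some (b ⊓ a), V, hV, ?_⟩
      ext y
      simp [g, inf_assoc]
end

section
/- Let h : X → Y be a semilattice homomorphism (i.e., h(a ⊓ b) = h(a) ⊓ h(b) for all a, b ∈ X) from a chain-finite semilattice X to a Hausdorff semitopological semilattice Y. Then the image h(X) is a closed subset of Y. -/
theorem wellFoundedGT_of_finite_chains {X : Type*} [PartialOrder X]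
    (hchain : ∀ C : Set X, IsChain (· ≤ ·) C → C.Finite) : WellFoundedGT X := by
  rw [wellFoundedGT_iff_monotone_chain_condition']
  intro a
  by_contra! hcon
  choose f hf hlt using hcon
  have hfin := hchain _ a.monotone.isChain_range
  obtain ⟨b, ⟨n, rfl⟩, hb⟩ := hfin.exists_maximal (Set.range_nonempty a)
  exact (hlt n).not_ge (hb ⟨f n, rfl⟩ (hlt n).le)

theorem wellFoundedLT_of_finite_chains {X : Type*} [PartialOrder X]
    (hchain : ∀ C : Set X, IsChain (· ≤ ·) C → C.Finite) : WellFoundedLT X := by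
  have : WellFoundedGT Xᵒᵈ := wellFoundedGT_of_finite_chains fun C hC => hchain C hC.symm
  exact wellFoundedGT_dual_iff X |>.1 this

/-- If `X` is well-founded, an inf-homomorphism has a strictly monotone section on its range,
sending each point to the least element of its fiber. -/
theorem exists_strictMono_section {X Y : Type*} [SemilatticeInf X] [SemilatticeInf Y]
    [WellFoundedLT X] (h : X → Y) (hhom : ∀ a b : X, h (a ⊓ b) = h a ⊓ h b) :
    ∃ m : Set.range h → X, StrictMono m := by
  have hleast : ∀ y : Set.range h, ∃ x, h x = y ∧ ∀ x', h x' = y → x ≤ x' := by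
    rintro ⟨_, x₀, rfl⟩
    obtain ⟨x, hx, hmin⟩ := wellFounded_lt.has_min {x | h x = h x₀} ⟨x₀, rfl⟩
    refine ⟨x, hx, fun x' hx' => ?_⟩
    have hmem : h (x ⊓ x') = h x₀ := by
      rw [hhom, hx, hx', inf_idem]
    exact inf_eq_left.1 (eq_of_le_of_not_lt inf_le_left (hmin _ hmem))
  choose m hm hle using hleast
  refine ⟨m, Monotone.strictMono_of_injective (fun y z hyz => ?_) fun y z hyz => ?_⟩
  · refine (hle y (m y ⊓ m z) ?_).trans inf_le_right
    rw [hhom, hm, hm]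
    exact inf_eq_left.2 hyz
  · exact Subtype.ext ((hm y).symm.trans ((congrArg h hyz).trans (hm z)))

section Semitopological

variable {Y : Type*} [SemilatticeInf Y] [TopologicalSpace Y] [T2Space Y] {S : Set Y}

/-- A point isolated from below at all smaller elements of `S` is itself isolated from below. -/
theorem notMem_closure_inter_Iio_of_forall_lt [WellFoundedGT S]
    (hsemi : ∀ a : Y, Continuous fun y => a ⊓ y) (hS : InfClosed S) (y : Y)
    (hlt : ∀ e ∈ S, e < y → e ∉ closure (S ∩ Set.Iio e)) :
    y ∉ closure (S ∩ Set.Iio y) := by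
  intro hy
  obtain ⟨s₀, hs₀, hs₀y⟩ := closure_nonempty_iff.1 ⟨y, hy⟩
  obtain ⟨⟨e, heS⟩, hey, hmax⟩ :=
    (wellFounded_gt (α := S)).has_min {s | (s : Y) < y} ⟨⟨s₀, hs₀⟩, hs₀y⟩
  simp only [Set.mem_ofPred_eq] at hey hmax
  have hnhds : {s | e ⊓ s ∉ closure (S ∩ Set.Iio e)} ∈ nhds y := by
    refine (hsemi e).continuousAt (isClosed_closure.isOpen_compl.mem_nhds ?_)
    change e ⊓ y ∉ _
    rw [inf_eq_left.2 hey.le]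
    exact hlt e heS hey
  have hsub : (S ∩ Set.Iio y) ∩ {s | e ⊓ s ∉ closure (S ∩ Set.Iio e)} ⊆ {e} := by
    rintro s ⟨⟨hsS, hsy⟩, hs⟩
    have hes : e ≤ s := by
      by_contra hne
      exact hs (subset_closure ⟨hS heS hsS, inf_lt_left.2 hne⟩)
    by_contra hse
    exact hmax ⟨s, hsS⟩ hsy (Subtype.mk_lt_mk.2 (lt_of_le_of_ne hes (Ne.symm hse)))
  have hye : y ∈ closure {e} :=
    closure_mono hsub (mem_closure_iff_nhdsWithin_neBot.2 (by
      rw [nhdsWithin_inter_of_mem' (mem_nhdsWithin_of_mem_nhds hnhds)]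
      exact mem_closure_iff_nhdsWithin_neBot.1 hy))
  rw [closure_singleton] at hye
  exact hey.ne' hye

theorem notMem_closure_inter_Iio [WellFoundedLT S] [WellFoundedGT S]
    (hsemi : ∀ a : Y, Continuous fun y => a ⊓ y) (hS : InfClosed S) (y : Y) :
    y ∉ closure (S ∩ Set.Iio y) := by
  refine notMem_closure_inter_Iio_of_forall_lt hsemi hS y fun e heS _ => ?_
  suffices ∀ e : S, (e : Y) ∉ closure (S ∩ Set.Iio (e : Y)) from this ⟨e, heS⟩
  intro e
  induction e using WellFoundedLT.induction with
  | ind e ih =>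
    exact notMem_closure_inter_Iio_of_forall_lt hsemi hS e fun f hf hfe => ih ⟨f, hf⟩ hfe

/-- A point of the closure of `T` whose meets with the elements of `T` lie in `S` belongs
to `S`. -/
theorem mem_of_mem_closure_of_inf_mem [WellFoundedLT S] [WellFoundedGT S]
    (hsemi : ∀ a : Y, Continuous fun y => a ⊓ y) (hS : InfClosed S) {T : Set Y} {y : Y}
    (hy : y ∈ closure T) (hT : ∀ t ∈ T, y ⊓ t ∈ S) : y ∈ S := by
  by_contra hyS
  refine notMem_closure_inter_Iio hsemi hS y ?_
  have hmaps : Set.MapsTo (fun t => y ⊓ t) T (S ∩ Set.Iio y) := fun t ht =>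
    ⟨hT t ht, lt_of_le_of_ne inf_le_left fun heq : y ⊓ t = y => hyS (heq ▸ hT t ht)⟩
  simpa using map_mem_closure (hsemi y) hy hmaps

theorem InfClosed.isClosed_of_wellFounded [WellFoundedLT S] [WellFoundedGT S]
    (hsemi : ∀ a : Y, Continuous fun y => a ⊓ y) (hS : InfClosed S) : IsClosed S := by
  refine isClosed_of_closure_subset fun y hy => ?_
  suffices hinf : ∀ x : S, (x : Y) ⊓ y ∈ S from
    mem_of_mem_closure_of_inf_mem hsemi hS hy fun t ht => inf_comm t y ▸ hinf ⟨t, ht⟩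
  intro x
  induction x using WellFoundedLT.induction with
  | ind x ih =>
    by_cases hxy : (x : Y) ≤ y
    · rw [inf_eq_left.2 hxy]
      exact x.2
    have hclosure : (x : Y) ⊓ y ∈ closure (insert (x : Y) (S ∩ Set.Iio (x : Y))) := by
      refine map_mem_closure (hsemi x) hy fun s hs => ?_
      rcases (inf_le_left : (x : Y) ⊓ s ≤ x).eq_or_lt with heq | hlt
      · exact Or.inl heq
      · exact Or.inr ⟨hS x.2 hs, hlt⟩
    rw [Set.insert_eq, closure_union, closure_singleton] at hclosure
    refine mem_of_mem_closure_of_inf_mem hsemi hS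
      (hclosure.resolve_left fun heq => hxy (inf_eq_left.1 heq)) ?_
    rintro t ⟨htS, htx⟩
    have : (x : Y) ⊓ y ⊓ t = t ⊓ y := by
      rw [inf_right_comm, inf_eq_right.2 (le_of_lt htx)]
    rw [this]
    exact ih ⟨t, htS⟩ htx

end Semitopological

/-- the homomorphic image of a chain-finite semilattice in a Hausdorff
semitopological semilattice is closed. -/
theorem stmt16 {X Y : Type*} [SemilatticeInf X] [SemilatticeInf Y] [TopologicalSpace Y]
    [T2Space Y]
    (hchain : ∀ C : Set X, IsChain (· ≤ ·) C → C.Finite)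
    (hsemi : ∀ a : Y, Continuous fun y => a ⊓ y)
    (h : X → Y) (hhom : ∀ a b : X, h (a ⊓ b) = h a ⊓ h b) :
    IsClosed (Set.range h) := by
  have := wellFoundedLT_of_finite_chains hchain
  have := wellFoundedGT_of_finite_chains hchain
  obtain ⟨m, hm⟩ := exists_strictMono_section h hhom
  have := hm.wellFoundedLT
  have := hm.wellFoundedGT
  refine InfClosed.isClosed_of_wellFounded hsemi ?_
  rintro _ ⟨a, rfl⟩ _ ⟨b, rfl⟩
  exact ⟨a ⊓ b, hhom a b⟩
end

section
/- Let h : X → Y be a continuous semilattice homomorphism (i.e., h(a ⊓ b) = h(a) ⊓ h(b) for all a, b ∈ X) from a complete topologized semilattice X to a Hausdorff topological semilattice Y (a semilattice with a Hausdorff topology making the operation (x, y) ↦ x ⊓ y jointly continuous). Then the image h(X) is a closed subset of Y. -/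
/-- A subsemilattice that contains the infima and suprema of its nonempty chains. -/
structure IsChainClosed {X : Type*} [SemilatticeInf X] (T : Set X) : Prop where
  inf_mem : ∀ a ∈ T, ∀ b ∈ T, a ⊓ b ∈ T
  glb_mem : ∀ C ⊆ T, C.Nonempty → IsChain (· ≤ ·) C → ∀ a, IsGLB C a → a ∈ T
  lub_mem : ∀ C ⊆ T, C.Nonempty → IsChain (· ≤ ·) C → ∀ a, IsLUB C a → a ∈ T

namespace IsChainClosed

variable {X : Type*} [SemilatticeInf X]

theorem sInter {c : Set (Set X)} (hc : ∀ T ∈ c, IsChainClosed T) : IsChainClosed (⋂₀ c) where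
  inf_mem a ha b hb T hT := (hc T hT).inf_mem a (ha T hT) b (hb T hT)
  glb_mem C hC hne hch a ha T hT :=
    (hc T hT).glb_mem C (fun _ hx => hC hx T hT) hne hch a ha
  lub_mem C hC hne hch a ha T hT :=
    (hc T hT).lub_mem C (fun _ hx => hC hx T hT) hne hch a ha

theorem inter {S T : Set X} (hS : IsChainClosed S) (hT : IsChainClosed T) :
    IsChainClosed (S ∩ T) := by
  rw [← Set.sInter_pair]
  apply sInter
  rintro _ (rfl | rfl) <;> assumption

theorem univ : IsChainClosed (Set.univ : Set X) := by
  constructor <;> intros <;> trivial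

theorem exists_isLeast [TopologicalSpace X] (hX : IsCompleteTopSemilattice X) {T : Set X}
    (hT : IsChainClosed T) (hne : T.Nonempty) : ∃ m, IsLeast T m := by
  obtain ⟨x₀, hx₀⟩ := hne
  obtain ⟨m, -, hm⟩ := zorn_le_nonempty₀ (α := Xᵒᵈ) (OrderDual.ofDual ⁻¹' T)
    (fun c hcT hc y hy => by
      have hc' : IsChain (· ≤ ·) (OrderDual.toDual ⁻¹' c) := hc.symm
      obtain ⟨⟨a, -, ha⟩, -⟩ := hX _ ⟨y, hy⟩ hc'
      exact ⟨OrderDual.toDual a, hT.glb_mem _ hcT ⟨y, hy⟩ hc' a ha, fun z hz => ha.1 hz⟩) x₀ hx₀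
  have hmT : OrderDual.ofDual m ∈ T := hm.prop
  refine ⟨OrderDual.ofDual m, hmT, fun t ht => ?_⟩
  have hle : OrderDual.ofDual m ≤ OrderDual.ofDual m ⊓ t :=
    hm.le_of_ge (y := OrderDual.toDual (OrderDual.ofDual m ⊓ t)) (hT.inf_mem _ hmT _ ht)
      (inf_le_left : OrderDual.ofDual m ⊓ t ≤ OrderDual.ofDual m)
  exact hle.trans inf_le_right

theorem sInter_nonempty_of_isChain [TopologicalSpace X] (hX : IsCompleteTopSemilattice X)
    {c : Set (Set X)} (hc : ∀ T ∈ c, IsChainClosed T) (hne : ∀ T ∈ c, T.Nonempty)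
    (hchain : IsChain (· ⊆ ·) c) (hcne : c.Nonempty) : (⋂₀ c).Nonempty := by
  have : Nonempty X := let ⟨T, hT⟩ := hcne; (hne T hT).to_type
  choose! m hm using fun T hT => (hc T hT).exists_isLeast hX (hne T hT)
  have hM : IsChain (· ≤ ·) (m '' c) := by
    rintro _ ⟨S, hS, rfl⟩ _ ⟨T, hT, rfl⟩ -
    rcases hchain.total hS hT with hST | hST
    · exact Or.inr ((hm T hT).2 (hST (hm S hS).1))
    · exact Or.inl ((hm S hS).2 (hST (hm T hT).1))
  obtain ⟨-, b, -, hb⟩ := hX _ (hcne.image m) hM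
  refine ⟨b, fun T hT => ?_⟩
  refine (hc T hT).lub_mem (m '' {S ∈ c | S ⊆ T}) ?_ ⟨m T, T, ⟨hT, subset_rfl⟩, rfl⟩
    (hM.mono (Set.image_mono fun _ hS => hS.1)) b ⟨?_, fun u hu => hb.2 ?_⟩
  · rintro _ ⟨S, ⟨hS, hST⟩, rfl⟩
    exact hST (hm S hS).1
  · rintro _ ⟨S, ⟨hS, -⟩, rfl⟩
    exact hb.1 ⟨S, hS, rfl⟩
  · rintro _ ⟨S, hS, rfl⟩
    rcases hchain.total hS hT with hST | hST
    · exact hu ⟨S, ⟨hS, hST⟩, rfl⟩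
    · exact ((hm S hS).2 (hST (hm T hT).1)).trans (hu ⟨T, ⟨hT, subset_rfl⟩, rfl⟩)

theorem sInter_nonempty_of_directedOn [TopologicalSpace X] (hX : IsCompleteTopSemilattice X)
    {F : Set (Set X)} (hF : ∀ S ∈ F, IsChainClosed S) (hne : ∀ S ∈ F, S.Nonempty)
    (hdir : DirectedOn (· ⊇ ·) F) (hFne : F.Nonempty) : (⋂₀ F).Nonempty := by
  obtain ⟨K, hK⟩ := zorn_superset {T : Set X | IsChainClosed T ∧ ∀ S ∈ F, (T ∩ S).Nonempty} (by
    intro c hc hchain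
    rcases c.eq_empty_or_nonempty with rfl | hcne
    · exact ⟨Set.univ, ⟨univ, by simpa using hne⟩, by simp⟩
    · refine ⟨⋂₀ c, ⟨sInter fun T hT => (hc hT).1, fun S hS => ?_⟩,
        fun T hT => Set.sInter_subset_of_mem hT⟩
      obtain ⟨x, hx⟩ := sInter_nonempty_of_isChain hX (c := (· ∩ S) '' c)
        (by rintro _ ⟨T, hT, rfl⟩; exact (hc hT).1.inter (hF S hS))
        (by rintro _ ⟨T, hT, rfl⟩; exact (hc hT).2 S hS)
        (by
          rintro _ ⟨T, hT, rfl⟩ _ ⟨T', hT', rfl⟩ -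
          exact (hchain.total hT hT').imp (fun h => Set.inter_subset_inter_left S h)
            (fun h => Set.inter_subset_inter_left S h))
        (hcne.image _)
      obtain ⟨T₀, hT₀⟩ := hcne
      exact ⟨x, fun T hT => (hx _ ⟨T, hT, rfl⟩).1, (hx _ ⟨T₀, hT₀, rfl⟩).2⟩)
  have hsub : ∀ S ∈ F, K ⊆ S := fun S hS => by
    have hmem : IsChainClosed (K ∩ S) ∧ ∀ R ∈ F, (K ∩ S ∩ R).Nonempty := by
      refine ⟨hK.prop.1.inter (hF S hS), fun R hR => ?_⟩
      obtain ⟨Q, hQ, hQS, hQR⟩ := hdir S hS R hR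
      obtain ⟨x, hxK, hxQ⟩ := hK.prop.2 Q hQ
      exact ⟨x, ⟨hxK, hQS hxQ⟩, hQR hxQ⟩
    exact (hK.le_of_le hmem Set.inter_subset_left).trans Set.inter_subset_right
  obtain ⟨S₀, hS₀⟩ := hFne
  obtain ⟨x, hxK, -⟩ := hK.prop.2 S₀ hS₀
  exact ⟨x, fun S hS => hsub S hS hxK⟩

end IsChainClosed

/-- A sequence of neighbourhoods of `y` in which the meet of any two points of each term lies in
the preceding term. -/
structure IsHalvingSeq {Y : Type*} [SemilatticeInf Y] [TopologicalSpace Y] (y : Y)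
    (U : ℕ → Set Y) : Prop where
  mem_nhds : ∀ n, U n ∈ nhds y
  inf_mem : ∀ n, ∀ a ∈ U (n + 1), ∀ b ∈ U (n + 1), a ⊓ b ∈ U n

namespace IsHalvingSeq

variable {X Y : Type*} [SemilatticeInf X] [TopologicalSpace X] [SemilatticeInf Y]
  [TopologicalSpace Y] {y : Y} {U V : ℕ → Set Y}

theorem inter (hU : IsHalvingSeq y U) (hV : IsHalvingSeq y V) :
    IsHalvingSeq y fun n => U n ∩ V n where
  mem_nhds n := Filter.inter_mem (hU.mem_nhds n) (hV.mem_nhds n)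
  inf_mem n a ha b hb := ⟨hU.inf_mem n a ha.1 b hb.1, hV.inf_mem n a ha.2 b hb.2⟩

theorem antitone (hU : IsHalvingSeq y U) : Antitone U :=
  antitone_nat_of_succ_le fun n a ha => by simpa using hU.inf_mem n a ha a ha

theorem exists_zero_eq (hYtop : Continuous fun p : Y × Y => p.1 ⊓ p.2) {W : Set Y}
    (hW : W ∈ nhds y) : ∃ U, IsHalvingSeq y U ∧ U 0 = W := by
  have step : ∀ A : {A : Set Y // A ∈ nhds y}, ∃ B : {B : Set Y // B ∈ nhds y},
      ∀ a ∈ B.1, ∀ b ∈ B.1, a ⊓ b ∈ A.1 := by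
    rintro ⟨A, hA⟩
    have hpre : (fun p : Y × Y => p.1 ⊓ p.2) ⁻¹' A ∈ nhds (y, y) :=
      hYtop.continuousAt.preimage_mem_nhds (by simpa using hA)
    rw [nhds_prod_eq, Filter.mem_prod_same_iff] at hpre
    obtain ⟨B, hB, hBA⟩ := hpre
    exact ⟨⟨B, hB⟩, fun a ha b hb => hBA (Set.mk_mem_prod ha hb)⟩
  choose f hf using step
  let u : ℕ → {A : Set Y // A ∈ nhds y} := fun n => f^[n] ⟨W, hW⟩
  refine ⟨fun n => (u n).1, ⟨fun n => (u n).2, fun n a ha b hb => hf (u n) a ?_ b ?_⟩, rfl⟩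
  · simpa only [u, Function.iterate_succ_apply'] using ha
  · simpa only [u, Function.iterate_succ_apply'] using hb

theorem isChainClosed (hU : IsHalvingSeq y U) (hX : IsCompleteTopSemilattice X)
    (hYtop : Continuous fun p : Y × Y => p.1 ⊓ p.2) {h : X → Y} (hc : Continuous h)
    (hhom : ∀ a b : X, h (a ⊓ b) = h a ⊓ h b) :
    IsChainClosed {x | ∀ n, h x ∈ closure (U n)} where
  inf_mem a ha b hb n := by
    rw [hhom]
    exact map_mem_closure₂ hYtop (ha (n + 1)) (hb (n + 1)) (hU.inf_mem n)
  glb_mem C hC hne hch a ha n := by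
    obtain ⟨⟨a', ha', hglb⟩, -⟩ := hX C hne hch
    rw [ha.unique hglb]
    exact closure_minimal (fun x hx => hC hx n) (isClosed_closure.preimage hc) ha'
  lub_mem C hC hne hch a ha n := by
    obtain ⟨-, a', ha', hlub⟩ := hX C hne hch
    rw [ha.unique hlub]
    exact closure_minimal (fun x hx => hC hx n) (isClosed_closure.preimage hc) ha'

theorem exists_forall_mem_closure (hU : IsHalvingSeq y U) (hX : IsCompleteTopSemilattice X)
    {h : X → Y} (hc : Continuous h) (hhom : ∀ a b : X, h (a ⊓ b) = h a ⊓ h b)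
    (hy : y ∈ closure (Set.range h)) : ∃ x, ∀ n, h x ∈ closure (U n) := by
  have hex : ∀ n, ∃ x, h x ∈ U n := fun n => by
    obtain ⟨_, hz, x, rfl⟩ := mem_closure_iff_nhds.1 hy _ (hU.mem_nhds n)
    exact ⟨x, hz⟩
  choose x hx using hex
  let p : ℕ → ℕ → X := fun k => Nat.rec x (fun _ q n => x n ⊓ q (n + 1)) k
  have p_succ : ∀ k n, p (k + 1) n = x n ⊓ p k (n + 1) := fun _ _ => rfl
  have p_mem : ∀ k n, h (p k (n + 1)) ∈ U n := by
    intro k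
    induction k with
    | zero => exact fun n => hU.antitone n.le_succ (hx (n + 1))
    | succ k ih =>
      intro n
      rw [p_succ, hhom]
      exact hU.inf_mem n _ (hx (n + 1)) _ (ih (n + 1))
  have p_le : ∀ k n, p (k + 1) n ≤ p k n := by
    intro k
    induction k with
    | zero => exact fun n => inf_le_left
    | succ k ih =>
      intro n
      rw [p_succ (k + 1), p_succ k]
      exact inf_le_inf_left _ (ih (n + 1))
  have p_anti : ∀ n, Antitone fun k => p k n := fun n => antitone_nat_of_succ_le fun k => p_le k n
  choose z hz hzglb using fun n =>
    (hX (Set.range fun k => p k n) (Set.range_nonempty _) (p_anti n).isChain_range).1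
  have z_mem : ∀ n, h (z (n + 1)) ∈ closure (U n) := fun n =>
    closure_minimal (by rintro _ ⟨k, rfl⟩; exact subset_closure (p_mem k n))
      (isClosed_closure.preimage hc) (hz (n + 1))
  have z_mono : Monotone z := monotone_nat_of_le_succ fun n => (hzglb (n + 1)).2 <| by
    rintro _ ⟨k, rfl⟩
    exact ((hzglb n).1 ⟨k + 1, rfl⟩).trans inf_le_right
  obtain ⟨-, b, -, hb⟩ := hX (Set.range z) (Set.range_nonempty _) z_mono.isChain_range
  refine ⟨b, fun n => ?_⟩
  have tail_mono : Monotone fun k => z (k + n + 1) := fun i j hij => z_mono (by omega)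
  obtain ⟨-, b', hb', hlub⟩ := hX _ (Set.range_nonempty _) tail_mono.isChain_range
  have hbb : b = b' := by
    refine le_antisymm (hb.2 ?_) (hlub.2 ?_)
    · rintro _ ⟨k, rfl⟩
      exact (z_mono (by omega : k ≤ k + n + 1)).trans (hlub.1 ⟨k, rfl⟩)
    · rintro _ ⟨k, rfl⟩
      exact hb.1 ⟨k + n + 1, rfl⟩
  rw [hbb]
  refine closure_minimal ?_ (isClosed_closure.preimage hc) hb'
  rintro _ ⟨k, rfl⟩
  exact closure_mono (hU.antitone (Nat.le_add_left n k)) (z_mem (k + n))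

end IsHalvingSeq

/-- the continuous homomorphic image of a complete topologized semilattice in
a Hausdorff topological semilattice is closed. -/
theorem stmt17 {X Y : Type*} [SemilatticeInf X] [TopologicalSpace X]
    [SemilatticeInf Y] [TopologicalSpace Y] [T2Space Y]
    (hX : IsCompleteTopSemilattice X)
    (hYtop : Continuous fun p : Y × Y => p.1 ⊓ p.2)
    (h : X → Y) (hc : Continuous h) (hhom : ∀ a b : X, h (a ⊓ b) = h a ⊓ h b) :
    IsClosed (Set.range h) := by
  refine isClosed_of_closure_subset fun y hy => ?_
  obtain ⟨x, hx⟩ := IsChainClosed.sInter_nonempty_of_directedOn hX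
    (F := (fun U : ℕ → Set Y => {x | ∀ n, h x ∈ closure (U n)}) '' {U | IsHalvingSeq y U})
    (by rintro _ ⟨U, hU, rfl⟩; exact hU.isChainClosed hX hYtop hc hhom)
    (by rintro _ ⟨U, hU, rfl⟩; exact hU.exists_forall_mem_closure hX hc hhom hy)
    (by
      rintro _ ⟨U, hU, rfl⟩ _ ⟨V, hV, rfl⟩
      exact ⟨_, ⟨_, hU.inter hV, rfl⟩,
        fun x hx n => closure_mono Set.inter_subset_left (hx n),
        fun x hx n => closure_mono Set.inter_subset_right (hx n)⟩)
    (Set.Nonempty.image _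
      ((IsHalvingSeq.exists_zero_eq hYtop Filter.univ_mem).imp fun _ hU => hU.1))
  refine ⟨x, ?_⟩
  by_contra hne
  obtain ⟨A, B, hA, hB, hxA, hyB, hAB⟩ := t2_separation hne
  obtain ⟨U, hU, rfl⟩ := IsHalvingSeq.exists_zero_eq hYtop (hB.mem_nhds hyB)
  obtain ⟨w, hwA, hwB⟩ := mem_closure_iff.1 (hx _ ⟨U, hU, rfl⟩ 0) A hA hxA
  exact hAB.le_bot ⟨hwA, hwB⟩
end

section
/- Let h : X → Y be a continuous semilattice homomorphism (i.e., h(a ⊓ b) = h(a) ⊓ h(b) for all a, b ∈ X) from a complete topologized semilattice X to a sequential Hausdorff semitopological semilattice Y. Then the image h(X) is a closed subset of Y. -/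
open Filter Topology

section TailMeet

variable {X : Type*} [SemilatticeInf X]

/-- The finite meet `x n ⊓ x (n + 1) ⊓ ⋯ ⊓ x (n + d)`. -/
def tailMeet (x : ℕ → X) : ℕ → ℕ → X
  | n, 0 => x n
  | n, d + 1 => x n ⊓ tailMeet x (n + 1) d

theorem tailMeet_antitone (x : ℕ → X) (n : ℕ) : Antitone (tailMeet x n) := by
  refine antitone_nat_of_succ_le fun d => ?_
  induction d generalizing n with
  | zero => exact inf_le_left
  | succ d ih => exact inf_le_inf_left _ (ih (n + 1))

theorem tailMeet_le (x : ℕ → X) (n d : ℕ) : tailMeet x n d ≤ x (n + d) := by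
  induction d generalizing n with
  | zero => exact le_rfl
  | succ d ih =>
    have := ih (n + 1)
    rw [show n + 1 + d = n + (d + 1) by omega] at this
    exact inf_le_right.trans this

theorem le_tailMeet {x : ℕ → X} {n : ℕ} {b : X} (hb : ∀ k, n ≤ k → b ≤ x k) (d : ℕ) :
    b ≤ tailMeet x n d := by
  induction d generalizing n with
  | zero => exact hb n le_rfl
  | succ d ih => exact le_inf (hb n le_rfl) (ih fun k hk => hb k (by omega))

end TailMeet

namespace IsCompleteTopSemilattice

variable {X : Type*} [SemilatticeInf X] [TopologicalSpace X]

theorem exists_tail_glb (hX : IsCompleteTopSemilattice X) (x : ℕ → X) (n : ℕ) :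
    ∃ a ∈ closure (Set.range (tailMeet x n)),
      (∀ k, n ≤ k → a ≤ x k) ∧ ∀ b, (∀ k, n ≤ k → b ≤ x k) → b ≤ a := by
  obtain ⟨a, ha, hglb⟩ := (hX (Set.range (tailMeet x n)) (Set.range_nonempty _)
    (tailMeet_antitone x n).isChain_range).1
  refine ⟨a, ha, fun k hk => ?_, fun b hb => hglb.2 ?_⟩
  · obtain ⟨d, rfl⟩ := Nat.exists_eq_add_of_le hk
    exact (hglb.1 ⟨d, rfl⟩).trans (tailMeet_le x n d)
  · rintro _ ⟨d, rfl⟩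
    exact le_tailMeet hb d

/-- Every sequence in a complete topologized semilattice has a lower limit, lying in the closure
of the set of finite meets of consecutive terms. -/
theorem exists_lowerLimit (hX : IsCompleteTopSemilattice X) (x : ℕ → X) :
    ∃ l ∈ closure (⋃ n, Set.range (tailMeet x n)), IsLUB {z | ∀ᶠ w in map x atTop, z ≤ w} l := by
  choose a ha hle hglb using hX.exists_tail_glb x
  have hmono : Monotone a := fun m n hmn => hglb n _ fun k hk => hle m k (hmn.trans hk)
  obtain ⟨l, hl, hlub⟩ := (hX (Set.range a) (Set.range_nonempty _) hmono.isChain_range).2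
  refine ⟨l, ?_, fun z hz => ?_, fun b hb => hlub.2 ?_⟩
  · refine closure_minimal ?_ isClosed_closure hl
    rintro _ ⟨n, rfl⟩
    exact closure_mono (Set.subset_iUnion _ n) (ha n)
  · obtain ⟨n, hn⟩ := eventually_atTop.1 (eventually_map.1 hz)
    exact (hglb n z hn).trans (hlub.1 ⟨n, rfl⟩)
  · rintro _ ⟨n, rfl⟩
    exact hb (eventually_map.2 (eventually_atTop.2 ⟨n, hle n⟩))

/-- The lower limit of a sequence in a complete topologized semilattice. -/
noncomputable def lowerLimit (hX : IsCompleteTopSemilattice X) (x : ℕ → X) : X :=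
  (hX.exists_lowerLimit x).choose

theorem lowerLimit_mem_closure (hX : IsCompleteTopSemilattice X) (x : ℕ → X) :
    hX.lowerLimit x ∈ closure (⋃ n, Set.range (tailMeet x n)) :=
  (hX.exists_lowerLimit x).choose_spec.1

theorem lowerLimit_le_lowerLimit (hX : IsCompleteTopSemilattice X) {x x' : ℕ → X}
    (hxx' : map x' atTop ≤ map x atTop) : hX.lowerLimit x ≤ hX.lowerLimit x' :=
  (hX.exists_lowerLimit x).choose_spec.2.mono (hX.exists_lowerLimit x').choose_spec.2
    fun _ hz => hz.filter_mono hxx'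

end IsCompleteTopSemilattice

section Image

variable {X Y : Type*} [SemilatticeInf X] [SemilatticeInf Y] [TopologicalSpace Y]

theorem isClosed_setOf_le_of_continuous_inf [T2Space Y]
    (hY : ∀ a : Y, Continuous fun y => a ⊓ y) (c : Y) : IsClosed {w : Y | w ≤ c} := by
  simpa only [id, inf_eq_right] using isClosed_eq (hY c) continuous_id

/-- A sequence whose image converges to `y ∈ U` has a subsequence such that all finite meets of its
consecutive terms are mapped into `U`. -/
theorem exists_subseq_tailMeet_mem (hY : ∀ a : Y, Continuous fun y => a ⊓ y) {h : X → Y}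
    (hhom : ∀ a b : X, h (a ⊓ b) = h a ⊓ h b) {x : ℕ → X} {y : Y}
    (hx : Tendsto (h ∘ x) atTop (𝓝 y)) {U : Set Y} (hU : IsOpen U) (hyU : y ∈ U) :
    ∃ φ : ℕ → ℕ, Tendsto φ atTop atTop ∧ ∀ n d, h (tailMeet (x ∘ φ) n d) ∈ U := by
  have hnext : ∀ (n : ℕ) (V : {V : Set Y // IsOpen V ∧ y ∈ V}),
      ∃ k, n ≤ k ∧ h (x k) ∈ V.1 ∧ h (x k) ⊓ y ∈ V.1 := by
    rintro n ⟨V, hV, hyV⟩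
    have hxy : Tendsto (fun k => h (x k) ⊓ y) atTop (𝓝 y) := by
      simpa [inf_comm, Function.comp_def] using ((hY y).tendsto y).comp hx
    exact ((eventually_ge_atTop n).and
      ((hx.eventually (hV.mem_nhds hyV)).and (hxy.eventually (hV.mem_nhds hyV)))).exists
  choose k hk hkV hkyV using hnext
  let V : ℕ → {V : Set Y // IsOpen V ∧ y ∈ V} := fun n =>
    Nat.rec ⟨U, hU, hyU⟩
      (fun n V => ⟨V.1 ∩ (fun w => h (x (k n V)) ⊓ w) ⁻¹' V.1,
        V.2.1.inter (V.2.1.preimage (hY _)), V.2.2, hkyV n V⟩) n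
  have hVsucc : ∀ n, (V (n + 1)).1 =
      (V n).1 ∩ (fun w => h (x (k n (V n))) ⊓ w) ⁻¹' (V n).1 := fun _ => rfl
  have hVU : ∀ n, (V n).1 ⊆ U := by
    intro n
    induction n with
    | zero => exact subset_rfl
    | succ n ih => exact (hVsucc n ▸ Set.inter_subset_left).trans ih
  refine ⟨fun n => k n (V n), tendsto_atTop_mono (fun n => hk n (V n)) tendsto_id,
    fun n d => hVU n ?_⟩
  induction d generalizing n with
  | zero => exact hkV n (V n)
  | succ d ih =>
    have hmem := ih (n + 1)
    rw [hVsucc] at hmem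
    rw [tailMeet, hhom]
    exact hmem.2

variable [TopologicalSpace X]

/-- Some sequence with image converging to `y` has a lower limit whose image does not change under
passing to finer sequences. -/
theorem exists_stable_lowerLimit [T2Space Y] [SequentialSpace Y]
    (hX : IsCompleteTopSemilattice X) (hY : ∀ a : Y, Continuous fun y => a ⊓ y) {h : X → Y}
    (hc : Continuous h) (hmono : Monotone h) {x₀ : ℕ → X} {y : Y}
    (hx₀ : Tendsto (h ∘ x₀) atTop (𝓝 y)) :
    ∃ x : ℕ → X, Tendsto (h ∘ x) atTop (𝓝 y) ∧ ∀ x' : ℕ → X, map x' atTop ≤ map x atTop →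
      h (hX.lowerLimit x') = h (hX.lowerLimit x) := by
  let Q := {x : ℕ → X // Tendsto (h ∘ x) atTop (𝓝 y)}
  let L : Q → X := fun A => hX.lowerLimit A.1
  let r : Q → Q → Prop := fun A B =>
    A = B ∨ (map B.1 atTop ≤ map A.1 atTop ∧ h (L A) < h (L B))
  have r_filter : ∀ {A B}, r A B → map B.1 atTop ≤ map A.1 atTop := by
    rintro A B (rfl | hAB)
    exacts [le_rfl, hAB.1]
  have r_L : ∀ {A B}, r A B → L A ≤ L B := fun hAB =>
    hX.lowerLimit_le_lowerLimit (r_filter hAB)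
  have r_trans : ∀ {A B C}, r A B → r B C → r A C := by
    rintro A B C (rfl | hAB) (rfl | hBC)
    exacts [Or.inl rfl, Or.inr hBC, Or.inr hAB, Or.inr ⟨hBC.1.trans hAB.1, hAB.2.trans hBC.2⟩]
  have bounded : ∀ T : Set Q, IsChain r T → ∃ ub, ∀ A ∈ T, r A ub := by
    intro T hT
    rcases T.eq_empty_or_nonempty with rfl | ⟨A₀, hA₀⟩
    · exact ⟨⟨x₀, hx₀⟩, by simp⟩
    have total : ∀ A ∈ T, ∀ B ∈ T, ¬ r B A → r A B := by
      intro A hA B hB hBA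
      refine (hT hA hB ?_).resolve_right hBA
      rintro rfl
      exact hBA (Or.inl rfl)
    by_contra! hno
    have strict : ∀ A ∈ T, ∃ B ∈ T, map B.1 atTop ≤ map A.1 atTop ∧ h (L A) < h (L B) := by
      intro A hA
      obtain ⟨B, hB, hBA⟩ := hno A
      refine ⟨B, hB, (total A hA B hB hBA).resolve_left ?_⟩
      rintro rfl
      exact hBA (Or.inl rfl)
    by_cases hcof : ∃ g : ℕ → Q, (∀ n, g n ∈ T) ∧ ∀ A ∈ T, ∃ n, r A (g n)
    · obtain ⟨g, hgT, hg⟩ := hcof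
      have hdir : Directed (· ≥ ·) fun n => map (g n).1 atTop := by
        intro m n
        by_cases hmn : r (g m) (g n)
        · exact ⟨n, r_filter hmn, le_rfl⟩
        · exact ⟨m, le_rfl, r_filter (total _ (hgT n) _ (hgT m) hmn)⟩
      have : NeBot (⨅ n, map (g n).1 atTop) := iInf_neBot_of_directed' hdir fun _ => inferInstance
      obtain ⟨z, hz⟩ := exists_seq_tendsto (⨅ n, map (g n).1 atTop)
      have hzg : ∀ n, map z atTop ≤ map (g n).1 atTop := fun n => hz.trans (iInf_le _ n)
      have hzy : Tendsto (h ∘ z) atTop (𝓝 y) := by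
        have := (map_mono (m := h) (hzg 0)).trans (g 0).2
        rwa [map_map] at this
      obtain ⟨A, hA, hAz⟩ := hno ⟨z, hzy⟩
      obtain ⟨B, hB, hBA, hlt⟩ := strict A hA
      obtain ⟨n, hn⟩ := hg B hB
      have hzB : map z atTop ≤ map B.1 atTop := (hzg n).trans (r_filter hn)
      exact hAz (Or.inr ⟨hzB.trans hBA,
        hlt.trans_le (hmono (hX.lowerLimit_le_lowerLimit hzB))⟩)
    · push Not at hcof
      have hDclosed : IsClosed {w : Y | ∃ A ∈ T, w ≤ h (L A)} := by
        refine IsSeqClosed.isClosed fun u w hu huw => ?_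
        choose g hgT hg using hu
        obtain ⟨A, hA, hAg⟩ := hcof g hgT
        exact ⟨A, hA, (isClosed_setOf_le_of_continuous_inf hY _).mem_of_tendsto huw
          (Eventually.of_forall fun n =>
            (hg n).trans (hmono (r_L (total _ (hgT n) A hA (hAg n)))))⟩
      have hchain : IsChain (· ≤ ·) (L '' T) := by
        rintro _ ⟨A, hA, rfl⟩ _ ⟨B, hB, rfl⟩ -
        by_cases hAB : r A B
        · exact Or.inl (r_L hAB)
        · exact Or.inr (r_L (total B hB A hA hAB))
      obtain ⟨c, hcl, hlub⟩ := (hX (L '' T) ⟨_, A₀, hA₀, rfl⟩ hchain).2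
      obtain ⟨A, hA, hcA⟩ : h c ∈ {w : Y | ∃ A ∈ T, w ≤ h (L A)} := by
        refine closure_minimal (t := h ⁻¹' {w : Y | ∃ A ∈ T, w ≤ h (L A)}) ?_
          (hDclosed.preimage hc) hcl
        rintro _ ⟨A, hA, rfl⟩
        exact ⟨A, hA, le_rfl⟩
      obtain ⟨B, hB, -, hlt⟩ := strict A hA
      exact ((hmono (hlub.1 ⟨B, hB, rfl⟩)).trans hcA).not_gt hlt
  obtain ⟨M, hM⟩ := exists_maximal_of_chains_bounded bounded r_trans
  refine ⟨M.1, M.2, fun x' hx' => ?_⟩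
  have hle : h (L M) ≤ h (hX.lowerLimit x') := hmono (hX.lowerLimit_le_lowerLimit hx')
  have hx'y : Tendsto (h ∘ x') atTop (𝓝 y) := by
    have := (map_mono (m := h) hx').trans M.2
    rwa [map_map] at this
  by_contra hne
  have hlt : h (L M) < h (hX.lowerLimit x') := lt_of_le_of_ne hle (Ne.symm hne)
  have hfilter := r_filter (hM ⟨x', hx'y⟩ (Or.inr ⟨hx', hlt⟩))
  exact hlt.not_ge (hmono (hX.lowerLimit_le_lowerLimit hfilter))

end Image

/-- the continuous homomorphic image of a complete topologized semilattice in
a sequential Hausdorff semitopological semilattice is closed. -/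
theorem stmt18 {X Y : Type*} [SemilatticeInf X] [TopologicalSpace X]
    [SemilatticeInf Y] [TopologicalSpace Y] [T2Space Y] [SequentialSpace Y]
    (hX : IsCompleteTopSemilattice X)
    (hYsemi : ∀ a : Y, Continuous fun y => a ⊓ y)
    (h : X → Y) (hc : Continuous h) (hhom : ∀ a b : X, h (a ⊓ b) = h a ⊓ h b) :
    IsClosed (Set.range h) := by
  have hmono : Monotone h := fun a b hab => by
    rw [← inf_eq_left, ← hhom, inf_eq_left.2 hab]
  refine IsSeqClosed.isClosed fun u y hu huy => ?_
  choose x₀ hx₀ using hu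
  obtain ⟨x, hxy, hstable⟩ := exists_stable_lowerLimit hX hYsemi hc hmono (x₀ := x₀) (y := y)
    (by simpa only [Function.comp_def, hx₀] using huy)
  refine ⟨hX.lowerLimit x, ?_⟩
  by_contra hne
  obtain ⟨V, U, hV, hU, hlV, hyU, hdisj⟩ := t2_separation hne
  obtain ⟨φ, hφ, hmem⟩ := exists_subseq_tailMeet_mem hYsemi hhom hxy hU hyU
  have hfiner : map (x ∘ φ) atTop ≤ map x atTop := by
    rw [← map_map]
    exact map_mono hφ
  have hcl : hX.lowerLimit (x ∘ φ) ∈ h ⁻¹' closure U := by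
    refine closure_minimal (Set.iUnion_subset fun n => ?_) (isClosed_closure.preimage hc)
      (hX.lowerLimit_mem_closure (x ∘ φ))
    rintro _ ⟨d, rfl⟩
    exact subset_closure (hmem n d)
  rw [Set.mem_preimage, hstable _ hfiner] at hcl
  exact (hdisj.closure_right hV).le_bot ⟨hlV, hcl⟩
end

section
/- A Hausdorff semitopological semilattice X is chain-compact (i.e., every closed chain in X is compact) if and only if X is complete (i.e., every nonempty chain C ⊆ X has a greatest lower bound and a least upper bound, both belonging to the closure of C in X). -/
/-- A chain has a lower bound in any compact set containing it, when the lower sets of its points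
are closed; stated for an arbitrary preorder relation, so that it also yields upper bounds. -/
theorem IsCompact.exists_forall_rel_of_isChain {X : Type*} [TopologicalSpace X] {r : X → X → Prop}
    [Std.Refl r] [IsTrans X r] {K C : Set X} (hK : IsCompact K) (hKc : IsClosed K)
    (hr : ∀ c, IsClosed {x | r x c}) (hCK : C ⊆ K) (hne : C.Nonempty) (hC : IsChain r C) :
    ∃ a ∈ K, ∀ c ∈ C, r a c := by
  have := hne.to_subtype
  obtain ⟨a, ha⟩ := IsCompact.nonempty_iInter_of_directed_nonempty_isCompact_isClosed
    (fun c : C => K ∩ {x | r x c})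
    (by
      intro c d
      rcases hC.total c.2 d.2 with h | h
      · exact ⟨c, subset_rfl, fun x hx => ⟨hx.1, _root_.trans hx.2 h⟩⟩
      · exact ⟨d, fun x hx => ⟨hx.1, _root_.trans hx.2 h⟩, subset_rfl⟩)
    (fun c => ⟨c, hCK c.2, refl_of r _⟩)
    (fun c => hK.inter_right (hr c)) (fun c => hKc.inter (hr c))
  simp only [Set.mem_iInter] at ha
  obtain ⟨c, hc⟩ := hne
  exact ⟨a, (ha ⟨c, hc⟩).1, fun d hd => (ha ⟨d, hd⟩).2⟩

theorem isClosed_Iic_of_continuous_inf {X : Type*} [SemilatticeInf X] [TopologicalSpace X]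
    [T2Space X] (hsemi : ∀ a : X, Continuous fun x => a ⊓ x) (a : X) : IsClosed (Set.Iic a) := by
  have : Set.Iic a = {x | a ⊓ x = x} := by ext x; simp
  exact this ▸ isClosed_eq (hsemi a) continuous_id

theorem isClosed_Ici_of_continuous_inf {X : Type*} [SemilatticeInf X] [TopologicalSpace X]
    [T1Space X] (hsemi : ∀ a : X, Continuous fun x => a ⊓ x) (a : X) : IsClosed (Set.Ici a) := by
  have : Set.Ici a = (fun x => a ⊓ x) ⁻¹' {a} := by ext x; simp
  exact this ▸ isClosed_singleton.preimage (hsemi a)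

theorem IsChain.closure_of_isClosed {X : Type*} [PartialOrder X] [TopologicalSpace X]
    (hIic : ∀ a : X, IsClosed (Set.Iic a)) (hIci : ∀ a : X, IsClosed (Set.Ici a))
    {C : Set X} (hC : IsChain (· ≤ ·) C) : IsChain (· ≤ ·) (closure C) := by
  have key : ∀ d, (∀ c ∈ C, c ≤ d ∨ d ≤ c) → ∀ e ∈ closure C, e ≤ d ∨ d ≤ e := fun d hd =>
    closure_minimal hd ((hIic d).union (hIci d))
  exact fun x hx y hy _ =>
    key y (fun c hc => (key c (fun e he => hC.total he hc) y hy).symm) x hx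

theorem isCompleteTopSemilattice_of_isCompact_chains {X : Type*} [SemilatticeInf X]
    [TopologicalSpace X] (hIic : ∀ a : X, IsClosed (Set.Iic a))
    (hIci : ∀ a : X, IsClosed (Set.Ici a))
    (h : ∀ C : Set X, IsChain (· ≤ ·) C → IsClosed C → IsCompact C) :
    IsCompleteTopSemilattice X := by
  intro C hne hC
  have hK := h _ (hC.closure_of_isClosed hIic hIci) isClosed_closure
  obtain ⟨a, ha, hac⟩ := hK.exists_forall_rel_of_isChain isClosed_closure hIic subset_closure hne hC
  obtain ⟨b, hb, hbc⟩ := hK.exists_forall_rel_of_isChain (r := (· ≥ ·)) isClosed_closure hIci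
    subset_closure hne hC.symm
  exact ⟨⟨a, ha, hac, fun d hd => closure_minimal hd (hIci d) ha⟩,
    b, hb, hbc, fun d hd => closure_minimal hd (hIic d) hb⟩

/-- An ultrafilter on a closed chain `C` converges to the supremum of all `x ∈ C` whose upper set
is large. -/
theorem IsCompleteTopSemilattice.isCompact_of_isChain {X : Type*} [SemilatticeInf X]
    [TopologicalSpace X] (h : IsCompleteTopSemilattice X) {C : Set X} (hC : IsChain (· ≤ ·) C)
    (hcl : IsClosed C) : IsCompact C := by
  rw [isCompact_iff_ultrafilter_le_nhds']
  intro F hCF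
  obtain ⟨m, hm, hmC⟩ := (h C (F.nonempty_of_mem hCF) hC).1
  rw [hcl.closure_eq] at hm
  let L : Set X := {x ∈ C | Set.Ici x ∈ F}
  have hLC : L ⊆ C := fun x hx => hx.1
  obtain ⟨s, hs, hsL⟩ := (h L ⟨m, hm, Filter.mem_of_superset hCF hmC.1⟩ (hC.mono hLC)).2
  have hsC : s ∈ C := closure_minimal hLC hcl hs
  refine ⟨s, hsC, fun V hV => ?_⟩
  obtain ⟨U, hUV, hU, hsU⟩ := mem_nhds_iff.1 hV
  have closure_diff {D : Set X} (hD : D ⊆ C \ U) : closure D ⊆ C \ U :=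
    closure_minimal hD (hcl.sdiff hU)
  have hlow : ∃ A ∈ F, ∀ p ∈ A, p ∈ C → p ≤ s → p ∈ U := by
    rcases ((C \ U) ∩ Set.Iic s).eq_empty_or_nonempty with hD | hD
    · exact ⟨C, hCF, fun p _ hpC hps => by_contra fun hpU =>
        hD.subset (show p ∈ (C \ U) ∩ Set.Iic s from ⟨⟨hpC, hpU⟩, hps⟩)⟩
    · obtain ⟨y, hy, hyD⟩ := (h _ hD (hC.mono fun x hx => hx.1.1)).2
      have hy := closure_diff Set.inter_subset_left hy
      have hys : y ≤ s := hyD.2 fun x hx => hx.2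
      obtain ⟨x, hxL, hxy⟩ : ∃ x ∈ L, ¬ x ≤ y := by
        by_contra! hcon
        exact hy.2 (hys.antisymm (hsL.2 hcon) ▸ hsU)
      exact ⟨_, hxL.2, fun p hxp hpC hps => by_contra fun hpU =>
        hxy (le_trans hxp (hyD.1 ⟨⟨hpC, hpU⟩, hps⟩))⟩
  have hup : ∃ A ∈ F, ∀ p ∈ A, p ∈ C → s ≤ p → p ∈ U := by
    rcases ((C \ U) ∩ Set.Ici s).eq_empty_or_nonempty with hD | hD
    · exact ⟨C, hCF, fun p _ hpC hps => by_contra fun hpU =>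
        hD.subset (show p ∈ (C \ U) ∩ Set.Ici s from ⟨⟨hpC, hpU⟩, hps⟩)⟩
    · obtain ⟨z, hz, hzD⟩ := (h _ hD (hC.mono fun x hx => hx.1.1)).1
      have hz := closure_diff Set.inter_subset_left hz
      have hsz : s ≤ z := hzD.2 fun x hx => hx.2
      have hzF : Set.Ici z ∉ F := fun hzF =>
        hz.2 (hsz.antisymm (hsL.1 ⟨hz.1, hzF⟩) ▸ hsU)
      exact ⟨_, Ultrafilter.compl_mem_iff_notMem.2 hzF, fun p hzp hpC hps => by_contra fun hpU =>
        hzp (hzD.1 ⟨⟨hpC, hpU⟩, hps⟩)⟩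
  obtain ⟨A, hA, hAU⟩ := hlow
  obtain ⟨B, hB, hBU⟩ := hup
  filter_upwards [hA, hB, hCF] with p hpA hpB hpC
  exact hUV ((hC.total hpC hsC).elim (hAU p hpA hpC) (hBU p hpB hpC))

/-- a Hausdorff semitopological semilattice is chain-compact iff it is
complete. -/
theorem stmt19 {X : Type*} [SemilatticeInf X] [TopologicalSpace X] [T2Space X]
    (hsemi : ∀ a : X, Continuous fun x => a ⊓ x) :
    (∀ C : Set X, IsChain (· ≤ ·) C → IsClosed C → IsCompact C) ↔
      IsCompleteTopSemilattice X := by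
  exact ⟨isCompleteTopSemilattice_of_isCompact_chains (isClosed_Iic_of_continuous_inf hsemi)
    (isClosed_Ici_of_continuous_inf hsemi), fun h _ hC hcl => h.isCompact_of_isChain hC hcl⟩
end
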